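/- Let A^(0), A^(1) ∈ (0,∞)^E be two initial weight vectors, μ_s := μ_{v0,A^(s)} for s ∈ {0,1}, and for s ∈ {0,1} and v ∈ V set a_v^(s) := Σ_{e∋v} a_e^(s) and b_v^(s) := (a_v^(s) + 1 − 𝟙(v=v0))/2. Then the KL divergence between the two environment laws satisfies D(μ_0 ‖ μ_1) = Σ_{e∈E} Λ(a_e^(0), a_e^(1)) − Σ_{v∈V} Λ(b_v^(0), b_v^(1)). -/

import Mathlib

open MeasureTheory Real Filter
open scoped ENNReal NNReal Classical BigOperators

noncomputable section

namespace ERRW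

variable {V : Type*} [Fintype V] [DecidableEq V]

/-- Total weight at a vertex: sum of the edge weights over the edges incident to `i`. -/
def vw (G : SimpleGraph V) [DecidableRel G.Adj] (w : Sym2 V → ℝ) (i : V) : ℝ :=
  ∑ j ∈ G.neighborFinset i, w s(i, j)

/-- Product of a vertex function over the two endpoints of an unordered pair. -/
def sprod (f : V → ℝ) : Sym2 V → ℝ :=
  Sym2.lift ⟨fun i j => f i * f j, fun i j => mul_comm _ _⟩

/-- Sum of a vertex function over the two endpoints of an unordered pair. -/
def ssum (f : V → ℝ) : Sym2 V → ℝ :=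
  Sym2.lift ⟨fun i j => f i + f j, fun i j => add_comm _ _⟩

/-- Quenched transition probability `p_{ij}(w) = w_{ij}/w_i`. -/
def qstep (G : SimpleGraph V) [DecidableRel G.Adj] (w : Sym2 V → ℝ) (i j : V) : ℝ :=
  if G.Adj i j then w s(i, j) / vw G w i else 0

/-- Stationary distribution `π_i(w) = w_i / Σ_v w_v` of the quenched chain. -/
def statDist (G : SimpleGraph V) [DecidableRel G.Adj] (w : Sym2 V → ℝ) (i : V) : ℝ :=
  vw G w i / ∑ v : V, vw G w v

/-- Spanning trees of `G`, as edge sets. -/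
def spanningTrees (G : SimpleGraph V) [DecidableRel G.Adj] : Finset (Finset (Sym2 V)) :=
  G.edgeFinset.powerset.filter fun F =>
    (SimpleGraph.fromEdgeSet (F : Set (Sym2 V))).IsTree

/-- Spanning-tree polynomial `τ(w) = Σ_{T} Π_{e ∈ T} w_e`. -/
def tau (G : SimpleGraph V) [DecidableRel G.Adj] (w : Sym2 V → ℝ) : ℝ :=
  ∑ F ∈ spanningTrees G, ∏ e ∈ F, w e

/-- Vertex parameter `b_v = (B_v + 1 - 𝟙(v = x))/2`. -/
def bwt (G : SimpleGraph V) [DecidableRel G.Adj] (x : V) (B : Sym2 V → ℝ) (v : V) : ℝ :=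
  (vw G B v + 1 - if v = x then 1 else 0) / 2

/-- The normalizing constant `Z_{x,B}` of the magic formula. -/
def Znorm (G : SimpleGraph V) [DecidableRel G.Adj] (x : V) (B : Sym2 V → ℝ) : ℝ :=
  ((∏ e ∈ G.edgeFinset, Real.Gamma (B e)) /
      ∏ v : V, Real.Gamma (bwt G x B v)) *
    Real.pi ^ (((Fintype.card V : ℝ) - 1) / 2) /
    2 ^ ((1 : ℝ) - (Fintype.card V : ℝ) + ∑ e ∈ G.edgeFinset, B e)

/-- The magic-formula density of `μ_{x,B}` with respect to `Π_{e ≠ e0} dw_e`. -/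
def magicDensity (G : SimpleGraph V) [DecidableRel G.Adj] (x : V) (B : Sym2 V → ℝ)
    (w : Sym2 V → ℝ) : ℝ :=
  (Znorm G x B)⁻¹ * (vw G w x) ^ ((1 : ℝ) / 2) *
      (∏ e ∈ G.edgeFinset, w e ^ (B e - 1)) /
      (∏ v : V, (vw G w v) ^ ((vw G B v + 1) / 2)) *
    Real.sqrt (tau G w)

/-- Coordinates indexed by the non-reference edges. -/
abbrev Epin (G : SimpleGraph V) [DecidableRel G.Adj] (e0 : Sym2 V) :=
  {e : Sym2 V // e ∈ G.edgeFinset ∧ e ≠ e0}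

/-- Extension of non-reference edge coordinates to a pinned environment (`w_{e0} = 1`). -/
def pinExt (G : SimpleGraph V) [DecidableRel G.Adj] (e0 : Sym2 V)
    (u : Epin G e0 → ℝ) : Sym2 V → ℝ :=
  fun e => if e = e0 then 1 else if h : e ∈ G.edgeFinset ∧ e ≠ e0 then u ⟨e, h⟩ else 0

/-- The mixing measure `μ_{x,B}` of the magic formula, as a measure on
environments pinned at the reference edge `e0`. -/
def mixing (G : SimpleGraph V) [DecidableRel G.Adj] (e0 : Sym2 V) (x : V) (B : Sym2 V → ℝ) :
    Measure (Sym2 V → ℝ) :=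
  Measure.map (pinExt G e0)
    ((volume : Measure (Epin G e0 → ℝ)).withDensity fun u =>
      ENNReal.ofReal
        (if ∀ e ∈ G.edgeFinset, 0 < pinExt G e0 u e then
          magicDensity G x B (pinExt G e0 u) else 0))

/-- Kullback–Leibler divergence (natural logarithm), `+∞` if `P` is not
absolutely continuous with respect to `Q`. -/
def KL {Ω : Type*} [MeasurableSpace Ω] (P Q : Measure Ω) : EReal :=
  if P ≪ Q then ((∫ x, Real.log (P.rnDeriv Q x).toReal ∂P : ℝ) : EReal) else ⊤

/-- Edge local time (current edge weight) at time `t` along a path. -/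
def localTime (a : Sym2 V → ℝ) (x : ℕ → V) (t : ℕ) (e : Sym2 V) : ℝ :=
  a e + ((Finset.range t).filter fun k => s(x k, x (k + 1)) = e).card

/-- One-step ERRW conditional probability at time `t` given the past of the path. -/
def errwStep (G : SimpleGraph V) [DecidableRel G.Adj] (a : Sym2 V → ℝ) (x : ℕ → V)
    (t : ℕ) : ℝ :=
  if G.Adj (x t) (x (t + 1)) then
    localTime a x t s(x t, x (t + 1)) /
      ∑ u ∈ G.neighborFinset (x t), localTime a x t s(x t, u)
  else 0

/-- Extension of a finite path to ℕ (junk value `v0` beyond time `T`). -/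
def extendPath {T : ℕ} (v0 : V) (x : Fin (T + 1) → V) : ℕ → V :=
  fun t => if h : t < T + 1 then x ⟨t, h⟩ else v0

/-- ERRW trajectory probability of a length-`T` path (the trajectory law mass function). -/
def errwProb (G : SimpleGraph V) [DecidableRel G.Adj] (v0 : V) (a : Sym2 V → ℝ) (T : ℕ)
    (x : Fin (T + 1) → V) : ℝ :=
  if x 0 = v0 then ∏ t ∈ Finset.range T, errwStep G a (extendPath v0 x) t else 0

/-- Undirected traversal count `N_e` of an edge along a finite path. -/
def edgeCount {T : ℕ} (v0 : V) (x : Fin (T + 1) → V) (e : Sym2 V) : ℕ :=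
  ((Finset.range T).filter fun k =>
    s(extendPath v0 x k, extendPath v0 x (k + 1)) = e).card

/-- Quenched path probability of a length-`T` path started at `v0`. -/
def quenchedProb (G : SimpleGraph V) [DecidableRel G.Adj] (v0 : V) (w : Sym2 V → ℝ) (T : ℕ)
    (x : Fin (T + 1) → V) : ℝ :=
  if x 0 = v0 then
    ∏ t ∈ Finset.range T, qstep G w (extendPath v0 x t) (extendPath v0 x (t + 1))
  else 0

/-- The measure on a finite type determined by a mass function. -/
def discreteMeasure {Ω : Type*} [Fintype Ω] [MeasurableSpace Ω] (p : Ω → ℝ) : Measure Ω :=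
  ∑ x : Ω, ENNReal.ofReal (p x) • Measure.dirac x

/-- Digamma function `Ψ = (log Γ)'`. -/
def digamma (x : ℝ) : ℝ := deriv (fun y => Real.log (Real.Gamma y)) x

/-- Trigamma function `Ψ₁ = Ψ'`. -/
def trigamma (x : ℝ) : ℝ := deriv digamma x

/-- `Λ(p,q) = log Γ(q) − log Γ(p) − (q−p)·Ψ(p)`. -/
def Lam (p q : ℝ) : ℝ :=
  Real.log (Real.Gamma q) - Real.log (Real.Gamma p) - (q - p) * digamma p

lemma lintegral_rpow_mul_exp {a r : ℝ} (ha : 0 < a) (hr : 0 < r) :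
    ∫⁻ x in Set.Ioi (0 : ℝ), ENNReal.ofReal (x ^ (a - 1) * exp (-(r * x))) =
      ENNReal.ofReal (r ^ (-a) * Gamma a) := by
  have h := integral_rpow_mul_exp_neg_mul_Ioi ha hr
  rw [← ofReal_integral_eq_lintegral_ofReal, h, one_div, Real.inv_rpow hr.le, Real.rpow_neg hr.le]
  · refine Integrable.of_integral_ne_zero ?_
    rw [h]
    have := Real.Gamma_pos_of_pos ha
    positivity
  · refine (ae_restrict_mem measurableSet_Ioi).mono fun x hx => ?_
    have : 0 < x := hx
    simp only [Pi.zero_apply]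
    positivity

lemma lintegral_rpow_mul_exp_div_sq {b w : ℝ} (hb : 0 < b) (hw : 0 < w) :
    ∫⁻ r in Set.Ioi (0 : ℝ), ENNReal.ofReal (2 * r ^ (-(2 * b) - 1) * exp (-(w / r ^ 2))) =
      ENNReal.ofReal (w ^ (-b) * Gamma b) := by
  rw [← lintegral_rpow_mul_exp hb hw]
  have himg : (fun r : ℝ => (r ^ 2)⁻¹) '' Set.Ioi 0 = Set.Ioi 0 := by
    ext x
    simp only [Set.mem_image, Set.mem_Ioi]
    constructor
    · rintro ⟨r, hr, rfl⟩
      positivity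
    · intro hx
      refine ⟨(√x)⁻¹, by positivity, ?_⟩
      rw [inv_pow, Real.sq_sqrt hx.le, inv_inv]
  have hderiv : ∀ r ∈ Set.Ioi (0 : ℝ),
      HasDerivWithinAt (fun r : ℝ => (r ^ 2)⁻¹) (-(2 * r) / (r ^ 2) ^ 2) (Set.Ioi 0) r := by
    intro r hr
    have hr : 0 < r := hr
    have := ((hasDerivAt_pow 2 r).inv (by positivity)).hasDerivWithinAt (s := Set.Ioi 0)
    exact this.congr_deriv (by simp)
  have hinj : Set.InjOn (fun r : ℝ => (r ^ 2)⁻¹) (Set.Ioi 0) := by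
    intro r hr s hs h
    have hr : 0 < r := hr
    have hs : 0 < s := hs
    have h : r ^ 2 = s ^ 2 := inv_injective h
    exact (pow_left_inj₀ hr.le hs.le two_ne_zero).1 h
  have h := lintegral_image_eq_lintegral_abs_deriv_mul measurableSet_Ioi hderiv hinj
    fun x => ENNReal.ofReal (x ^ (b - 1) * exp (-(w * x)))
  rw [himg] at h
  rw [h]
  refine setLIntegral_congr_fun measurableSet_Ioi fun r hr => ?_
  have hr : 0 < r := hr
  rw [← ENNReal.ofReal_mul (abs_nonneg _), neg_div, abs_neg, abs_of_pos (by positivity)]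
  congr 1
  rw [div_eq_mul_inv w, ← mul_assoc]
  congr 1
  have e1 : ((r ^ 2)⁻¹) ^ (b - 1) = r ^ (-(2 * (b - 1))) := by
    rw [← Real.rpow_natCast, ← Real.rpow_neg hr.le, ← Real.rpow_mul hr.le]
    congr 1
    push_cast
    ring
  have e2 : 2 * r / (r ^ 2) ^ 2 = 2 * r ^ (-3 : ℝ) := by
    rw [Real.rpow_neg hr.le, show (3 : ℝ) = ((3 : ℕ) : ℝ) by norm_num, Real.rpow_natCast]
    field_simp
  rw [e1, e2, mul_assoc, ← Real.rpow_add hr]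
  congr 2
  ring

lemma lintegral_exp_neg_sq :
    ∫⁻ t : ℝ, ENNReal.ofReal (exp (-t ^ 2)) = ENNReal.ofReal √π := by
  have h := integral_gaussian 1
  have hi := integrable_exp_neg_mul_sq one_pos
  simp only [neg_mul, one_mul, div_one] at h hi
  rw [← h, ofReal_integral_eq_lintegral_ofReal hi (ae_of_all _ fun t => (exp_pos _).le)]

/-- A substitution `x ↦ c ^ 2 / x` exchanging the two halves of the inverse Gaussian integral. -/
lemma lintegral_inverseGaussian_symm {c : ℝ} (hc : 0 < c) :
    ∫⁻ x in Set.Ioi (0 : ℝ), ENNReal.ofReal ((√x)⁻¹ * exp (-(x + c ^ 2 / x))) =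
      ∫⁻ x in Set.Ioi (0 : ℝ), ENNReal.ofReal (c / (x * √x) * exp (-(x + c ^ 2 / x))) := by
  have himg : (fun x : ℝ => c ^ 2 / x) '' Set.Ioi 0 = Set.Ioi 0 := by
    ext x
    simp only [Set.mem_image, Set.mem_Ioi]
    constructor
    · rintro ⟨r, hr, rfl⟩
      positivity
    · intro hx
      exact ⟨c ^ 2 / x, by positivity, by field_simp⟩
  have hderiv : ∀ x ∈ Set.Ioi (0 : ℝ),
      HasDerivWithinAt (fun x : ℝ => c ^ 2 / x) (-(c ^ 2 / x ^ 2)) (Set.Ioi 0) x := by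
    intro x hx
    have hx : 0 < x := hx
    have := ((hasDerivAt_inv hx.ne').const_mul (c ^ 2)).hasDerivWithinAt (s := Set.Ioi 0)
    simpa [div_eq_mul_inv] using this
  have hinj : Set.InjOn (fun x : ℝ => c ^ 2 / x) (Set.Ioi 0) := by
    intro r hr s hs h
    have hr : 0 < r := hr
    have hs : 0 < s := hs
    simp only at h
    field_simp at h
    exact h.symm
  have h := lintegral_image_eq_lintegral_abs_deriv_mul measurableSet_Ioi hderiv hinj
    fun x => ENNReal.ofReal ((√x)⁻¹ * exp (-(x + c ^ 2 / x)))
  rw [himg] at h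
  rw [h]
  refine setLIntegral_congr_fun measurableSet_Ioi fun x hx => ?_
  have hx : 0 < x := hx
  rw [← ENNReal.ofReal_mul (abs_nonneg _), abs_neg, abs_of_pos (by positivity), ← mul_assoc,
    Real.sqrt_div (by positivity), Real.sqrt_sq hc.le]
  have e : c ^ 2 / x + c ^ 2 / (c ^ 2 / x) = x + c ^ 2 / x := by
    field_simp
    ring
  rw [e]
  congr 2
  have hs : 0 < √x := Real.sqrt_pos.2 hx
  have := Real.mul_self_sqrt hx.le
  field_simp
  nlinarith

/-- Normalisation of the inverse Gaussian distribution. -/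
lemma lintegral_inverseGaussian {c : ℝ} (hc : 0 ≤ c) :
    ∫⁻ x in Set.Ioi (0 : ℝ), ENNReal.ofReal ((√x)⁻¹ * exp (-(x + c ^ 2 / x))) =
      ENNReal.ofReal (√π * exp (-(2 * c))) := by
  rcases hc.eq_or_lt with rfl | hc
  · have h := lintegral_rpow_mul_exp (a := 1 / 2) (r := 1) (by norm_num) one_pos
    rw [Real.Gamma_one_half_eq, Real.one_rpow, one_mul] at h
    rw [mul_zero, neg_zero, exp_zero, mul_one, ← h]
    refine setLIntegral_congr_fun measurableSet_Ioi fun x hx => ?_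
    have hx : 0 < x := hx
    rw [Real.sqrt_eq_rpow, ← Real.rpow_neg hx.le]
    norm_num
  have himg : (fun x : ℝ => √x - c / √x) '' Set.Ioi 0 = Set.univ := by
    refine Set.eq_univ_of_forall fun t => ?_
    have hlt : |t| < √(t ^ 2 + 4 * c) := by
      rw [← Real.sqrt_sq_eq_abs]
      exact Real.sqrt_lt_sqrt (sq_nonneg t) (by linarith)
    have hy : 0 < (t + √(t ^ 2 + 4 * c)) / 2 := by
      have := neg_abs_le t
      linarith
    refine ⟨((t + √(t ^ 2 + 4 * c)) / 2) ^ 2, Set.mem_Ioi.2 (by positivity), ?_⟩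
    have hsq := Real.sq_sqrt (show 0 ≤ t ^ 2 + 4 * c by positivity)
    simp only
    rw [Real.sqrt_sq hy.le, sub_eq_iff_eq_add, ← sub_eq_iff_eq_add', eq_div_iff hy.ne']
    nlinarith
  have hderiv : ∀ x ∈ Set.Ioi (0 : ℝ), HasDerivWithinAt (fun x : ℝ => √x - c / √x)
      (((√x)⁻¹ + c / (x * √x)) / 2) (Set.Ioi 0) x := by
    intro x hx
    have hx : 0 < x := hx
    have hs : 0 < √x := Real.sqrt_pos.2 hx
    have h1 := Real.hasDerivAt_sqrt hx.ne'
    have := (h1.sub ((h1.inv hs.ne').const_mul c)).hasDerivWithinAt (s := Set.Ioi 0)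
    refine this.congr_deriv ?_
    rw [Real.sq_sqrt hx.le]
    field_simp
    ring
  have hinj : Set.InjOn (fun x : ℝ => √x - c / √x) (Set.Ioi 0) := by
    refine StrictMonoOn.injOn fun x hx y hy hxy => ?_
    have hx : 0 < x := hx
    have h1 : √x < √y := Real.sqrt_lt_sqrt hx.le hxy
    have h0 : 0 < √x := Real.sqrt_pos.2 hx
    have : c / √y < c / √x := div_lt_div_of_pos_left hc h0 h1
    show √x - c / √x < √y - c / √y
    linarith
  have h := lintegral_image_eq_lintegral_abs_deriv_mul measurableSet_Ioi hderiv hinj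
    fun t => ENNReal.ofReal (exp (-t ^ 2))
  rw [himg, setLIntegral_univ, lintegral_exp_neg_sq] at h
  set A := ∫⁻ x in Set.Ioi (0 : ℝ), ENNReal.ofReal ((√x)⁻¹ * exp (-(x + c ^ 2 / x))) with hA
  have h2 : ∫⁻ x in Set.Ioi (0 : ℝ), ENNReal.ofReal |((√x)⁻¹ + c / (x * √x)) / 2| *
      ENNReal.ofReal (exp (-(√x - c / √x) ^ 2)) = ENNReal.ofReal (exp (2 * c)) * A := by
    have h3 : ENNReal.ofReal (exp (2 * c)) * A = ENNReal.ofReal (exp (2 * c) / 2) * (A +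
        ∫⁻ x in Set.Ioi (0 : ℝ), ENNReal.ofReal (c / (x * √x) * exp (-(x + c ^ 2 / x)))) := by
      rw [← lintegral_inverseGaussian_symm hc, ← hA, ← two_mul, ← mul_assoc]
      congr 1
      rw [← ENNReal.ofReal_ofNat 2, ← ENNReal.ofReal_mul (by positivity)]
      congr 1
      ring
    rw [h3, hA, ← lintegral_add_left (by fun_prop), ← lintegral_const_mul _ (by fun_prop)]
    refine setLIntegral_congr_fun measurableSet_Ioi fun x hx => ?_
    have hx : 0 < x := hx
    have hs : 0 < √x := Real.sqrt_pos.2 hx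
    rw [abs_of_pos (by positivity), ← ENNReal.ofReal_mul (by positivity),
      ← ENNReal.ofReal_add (by positivity) (by positivity), ← ENNReal.ofReal_mul (by positivity)]
    congr 1
    have e : exp (-(√x - c / √x) ^ 2) = exp (2 * c) * exp (-(x + c ^ 2 / x)) := by
      rw [← exp_add]
      congr 1
      rw [sub_sq, div_pow, Real.sq_sqrt hx.le]
      field_simp
      ring
    rw [e]
    ring
  rw [h2] at h
  rw [mul_comm √π, ENNReal.ofReal_mul (exp_pos _).le, h, ← mul_assoc,
    ← ENNReal.ofReal_mul (exp_pos _).le, ← exp_add]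
  simp

section RandomSchroedinger

open Matrix

variable {ι κ : Type*} [Fintype ι] [DecidableEq ι] [Fintype κ] [DecidableEq κ]

lemma inv_mulVec_eq_of_mulVec_eq {M : Matrix ι ι ℝ} (hM : M.PosDef) {r η : ι → ℝ}
    (h : M *ᵥ r = η) : M⁻¹ *ᵥ η = r := by
  rw [← h, mulVec_mulVec, nonsing_inv_mul _ (isUnit_iff_isUnit_det _ |>.1 hM.isUnit), one_mulVec]

lemma mulVec_inv_mulVec {M : Matrix ι ι ℝ} (hM : M.PosDef) (η : ι → ℝ) :
    M *ᵥ (M⁻¹ *ᵥ η) = η := by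
  rw [mulVec_mulVec, mul_nonsing_inv _ (isUnit_iff_isUnit_det _ |>.1 hM.isUnit), one_mulVec]

lemma dotProduct_inv_mulVec_comm {M : Matrix ι ι ℝ} (hM : M.PosDef) (u v : ι → ℝ) :
    u ⬝ᵥ (M⁻¹ *ᵥ v) = v ⬝ᵥ (M⁻¹ *ᵥ u) := by
  have h : (M⁻¹)ᵀ = M⁻¹ := by
    have := hM.inv.isHermitian
    rwa [IsHermitian, conjTranspose_eq_transpose_of_trivial] at this
  rw [dotProduct_mulVec, ← mulVec_transpose, h, dotProduct_comm]

/-- The inverse of a positive definite matrix with nonpositive off-diagonal entries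
preserves nonnegative vectors. -/
lemma inv_mulVec_nonneg {M : Matrix ι ι ℝ} (hM : M.PosDef) (hoff : ∀ i j, i ≠ j → M i j ≤ 0)
    {η : ι → ℝ} (hη : ∀ i, 0 ≤ η i) (i : ι) : 0 ≤ (M⁻¹ *ᵥ η) i := by
  set r := M⁻¹ *ᵥ η with hr
  have hMr : M *ᵥ r = η := mulVec_inv_mulVec hM η
  set m : ι → ℝ := fun j => max (-r j) 0 with hm
  have hm0 : ∀ j, 0 ≤ m j := fun j => le_max_right _ _
  have key : m ⬝ᵥ (M *ᵥ m) ≤ -(m ⬝ᵥ (M *ᵥ r)) := by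
    rw [← dotProduct_neg, ← mulVec_neg]
    simp only [dotProduct, mulVec, Finset.mul_sum]
    refine Finset.sum_le_sum fun j _ => Finset.sum_le_sum fun k _ => ?_
    simp only [Pi.neg_apply]
    by_cases hjk : j = k
    · subst hjk
      rcases le_total (-r j) 0 with h | h
      · simp [hm, max_eq_right h]
      · simp [hm, max_eq_left h]
    · have h1 := hoff j k hjk
      have h2 : -r k ≤ m k := le_max_left _ _
      nlinarith [mul_nonneg (hm0 j) (mul_nonneg (neg_nonneg.2 h1) (sub_nonneg.2 h2))]
  have h0 : m ⬝ᵥ (M *ᵥ m) ≤ 0 := by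
    refine key.trans (neg_nonpos.2 ?_)
    rw [hMr]
    exact Finset.sum_nonneg fun j _ => mul_nonneg (hm0 j) (hη j)
  have hmz : m = 0 := by
    by_contra hne
    have := hM.dotProduct_mulVec_pos hne
    rw [star_trivial] at this
    linarith
  have h1 := congrFun hmz i
  have h2 : -r i ≤ m i := le_max_left _ _
  rw [h1] at h2
  simpa using h2

/-- A symmetric matrix bordered by one extra row and column. -/
def borderedMatrix (t : ℝ) (w : ι → ℝ) (D : Matrix ι ι ℝ) : Matrix (PUnit ⊕ ι) (PUnit ⊕ ι) ℝ :=
  fromBlocks (of fun _ _ => t) (of fun _ j => -w j) (of fun i _ => -w i) D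

lemma det_borderedMatrix {D : Matrix ι ι ℝ} (hD : D.PosDef) (t : ℝ) (w : ι → ℝ) :
    (borderedMatrix t w D).det = D.det * (t - w ⬝ᵥ (D⁻¹ *ᵥ w)) := by
  have := hD.isUnit.invertible
  rw [borderedMatrix, det_fromBlocks₂₂, invOf_eq_nonsing_inv, det_unique (n := PUnit)]
  congr 1
  rw [Matrix.sub_apply, of_apply, Matrix.mul_assoc, mul_apply]
  simp [dotProduct, mulVec, mul_apply]

lemma borderedMatrix_posDef_iff (t : ℝ) (w : ι → ℝ) (D : Matrix ι ι ℝ) :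
    (borderedMatrix t w D).PosDef ↔ D.PosDef ∧ 0 < t - w ⬝ᵥ (D⁻¹ *ᵥ w) := by
  have hsub : (borderedMatrix t w D).PosDef → D.PosDef := fun h =>
    h.submatrix (e := Sum.inr) Sum.inr_injective
  by_cases hD : D.PosDef
  swap
  · exact iff_of_false (fun h => hD (hsub h)) fun h => hD h.1
  have := hD.isUnit.invertible
  have hpsd : (borderedMatrix t w D).PosSemidef ↔ 0 ≤ t - w ⬝ᵥ (D⁻¹ *ᵥ w) := by
    have h := PosDef.fromBlocks₂₂ (of fun (_ _ : PUnit) => t) (of fun (_ : PUnit) j => -w j) hD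
    have e : (of fun (_ : PUnit) j => -w j)ᴴ = of fun i (_ : PUnit) => -w i := by
      ext i j
      simp
    rw [e] at h
    refine h.trans ?_
    have e2 : (of fun (_ _ : PUnit) => t) - (of fun (_ : PUnit) j => -w j) * D⁻¹ *
        (of fun i (_ : PUnit) => -w i) = diagonal fun _ => t - w ⬝ᵥ (D⁻¹ *ᵥ w) := by
      ext i j
      rw [Matrix.sub_apply, of_apply, Matrix.mul_assoc, mul_apply]
      simp [dotProduct, mulVec, mul_apply]
    rw [e2, posSemidef_diagonal_iff]
    simp
  constructor
  · intro h
    refine ⟨hD, lt_of_le_of_ne (hpsd.1 h.posSemidef) fun h0 => ?_⟩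
    have := h.det_pos
    rw [det_borderedMatrix hD, ← h0, mul_zero] at this
    exact lt_irrefl _ this
  · rintro ⟨-, h⟩
    rw [(hpsd.2 h.le).posDef_iff_det_ne_zero, det_borderedMatrix hD]
    exact mul_ne_zero hD.det_pos.ne' h.ne'

lemma borderedMatrix_quadratic {D : Matrix ι ι ℝ} (hD : D.PosDef) {t : ℝ} {w : ι → ℝ}
    (hx : 0 < t - w ⬝ᵥ (D⁻¹ *ᵥ w)) (s : ℝ) (η : ι → ℝ) :
    Sum.elim (fun _ => s) η ⬝ᵥ ((borderedMatrix t w D)⁻¹ *ᵥ Sum.elim (fun _ => s) η) =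
      η ⬝ᵥ (D⁻¹ *ᵥ η) + (s + w ⬝ᵥ (D⁻¹ *ᵥ η)) ^ 2 / (t - w ⬝ᵥ (D⁻¹ *ᵥ w)) := by
  have hM := (borderedMatrix_posDef_iff t w D).2 ⟨hD, hx⟩
  set x := t - w ⬝ᵥ (D⁻¹ *ᵥ w) with hxdef
  set c := s + w ⬝ᵥ (D⁻¹ *ᵥ η) with hc
  have hr : borderedMatrix t w D *ᵥ Sum.elim (fun _ => c / x) (D⁻¹ *ᵥ (η + (c / x) • w)) =
      Sum.elim (fun _ => s) η := by
    rw [borderedMatrix, fromBlocks_mulVec]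
    congr 1
    · ext i
      have e : (of fun (_ : PUnit) j => -w j) *ᵥ (D⁻¹ *ᵥ (η + (c / x) • w)) = fun _ =>
          -(w ⬝ᵥ (D⁻¹ *ᵥ η) + c / x * (w ⬝ᵥ (D⁻¹ *ᵥ w))) := by
        have hneg : ∀ u : ι → ℝ, (of fun (_ : PUnit) j => -w j) *ᵥ u = fun _ => -(w ⬝ᵥ u) :=
          fun u => funext fun _ => neg_dotProduct w u
        rw [hneg, mulVec_add, mulVec_smul, dotProduct_add, dotProduct_smul, smul_eq_mul]
      rw [Sum.elim_comp_inl, Sum.elim_comp_inr, e]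
      simp only [Pi.add_apply, mulVec, dotProduct, of_apply, Finset.univ_unique,
        Finset.sum_singleton]
      have h1 : c / x * x = c := div_mul_cancel₀ _ hx.ne'
      have h2 : t = x + w ⬝ᵥ (D⁻¹ *ᵥ w) := by rw [hxdef]; ring
      simp only [mulVec, dotProduct] at h2 hc
      rw [h2]
      linear_combination h1 + hc
    · rw [Sum.elim_comp_inl, Sum.elim_comp_inr, mulVec_inv_mulVec hD]
      ext i
      simp [mulVec, dotProduct]
      ring
  rw [inv_mulVec_eq_of_mulVec_eq hM hr]
  have hs := dotProduct_inv_mulVec_comm hD η w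
  rw [dotProduct_block, mulVec_add, mulVec_smul]
  simp only [Sum.elim_comp_inl, Sum.elim_comp_inr, dotProduct_add, dotProduct_smul, hs, smul_eq_mul]
  simp only [dotProduct, Finset.univ_unique, Finset.sum_singleton]
  have : c ^ 2 / x = c * (c / x) := by ring
  rw [this]
  simp only [dotProduct] at hc
  linear_combination (-(c / x)) * hc

/-- The (unnormalised) density of the random Schrödinger potential on the cone where
`diagonal h - W` is positive definite. -/
def schroedingerDensity (W : Matrix ι ι ℝ) (η h : ι → ℝ) : ℝ≥0∞ :=
  if (diagonal h - W).PosDef then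
    ENNReal.ofReal ((√(diagonal h - W).det)⁻¹ *
      exp (-(∑ i, h i + η ⬝ᵥ ((diagonal h - W)⁻¹ *ᵥ η))))
  else 0

/-- The total mass formula for the random Schrödinger potential, with the measurability of its
support. -/
def HasSchroedingerMass (ι : Type*) [Fintype ι] [DecidableEq ι] : Prop :=
  ∀ W : Matrix ι ι ℝ, W.IsSymm → (∀ i j, 0 ≤ W i j) →
    MeasurableSet {h : ι → ℝ | (diagonal h - W).PosDef} ∧
    ∀ η : ι → ℝ, (∀ i, 0 ≤ η i) → ∫⁻ h, schroedingerDensity W η h =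
      ENNReal.ofReal (√π ^ Fintype.card ι * exp (-(∑ i, ∑ j, W i j + 2 * ∑ i, η i)))

lemma diagonal_sub_submatrix (e : ι ≃ κ) (W : Matrix κ κ ℝ) (h : κ → ℝ) :
    (diagonal (h ∘ e) - W.submatrix e e) = (diagonal h - W).submatrix e e := by
  rw [submatrix_sub, Pi.sub_apply, Pi.sub_apply, submatrix_diagonal_equiv]

lemma posDef_submatrix_equiv_iff (e : ι ≃ κ) (M : Matrix κ κ ℝ) :
    (M.submatrix e e).PosDef ↔ M.PosDef := by
  refine ⟨fun h => ?_, fun h => h.submatrix e.injective⟩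
  have := h.submatrix e.symm.injective
  simpa using this

lemma schroedingerDensity_comp_equiv (e : ι ≃ κ) (W : Matrix κ κ ℝ) (η h : κ → ℝ) :
    schroedingerDensity (W.submatrix e e) (η ∘ e) (h ∘ e) = schroedingerDensity W η h := by
  unfold schroedingerDensity
  rw [diagonal_sub_submatrix, posDef_submatrix_equiv_iff, det_submatrix_equiv_self,
    inv_submatrix_equiv, submatrix_mulVec_equiv]
  simp [Function.comp_assoc, Equiv.sum_comp e h]

lemma HasSchroedingerMass.of_equiv (e : ι ≃ κ) (hι : HasSchroedingerMass ι) :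
    HasSchroedingerMass κ := by
  intro W hW hW0
  obtain ⟨hm, hint⟩ := hι (W.submatrix e e) (hW.submatrix e) fun i j => hW0 _ _
  have hmp := volume_measurePreserving_piCongrLeft (fun _ : κ => ℝ) e
  have happ : ∀ g : ι → ℝ, (MeasurableEquiv.piCongrLeft (fun _ : κ => ℝ) e g) ∘ e = g :=
    fun g => funext fun i => MeasurableEquiv.piCongrLeft_apply_apply (β := fun _ => ℝ) e g i
  constructor
  · have : {h : κ → ℝ | (diagonal h - W).PosDef} =
        (fun h => h ∘ e) ⁻¹' {h : ι → ℝ | (diagonal h - W.submatrix e e).PosDef} := by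
      ext h
      rw [Set.mem_preimage, Set.mem_ofPred_eq, Set.mem_ofPred_eq, diagonal_sub_submatrix,
        posDef_submatrix_equiv_iff]
    rw [this]
    exact measurable_pi_iff.2 (fun i => measurable_pi_apply _) hm
  · intro η hη
    have h := hint (η ∘ e) fun i => hη _
    rw [← hmp.lintegral_comp_emb (MeasurableEquiv.measurableEmbedding _)]
    simp_rw [← schroedingerDensity_comp_equiv e W η, happ, h]
    congr 2
    · rw [Fintype.card_congr e]
    · have h1 : ∑ i, ∑ j, W.submatrix e e i j = ∑ i, ∑ j, W i j :=
        (Finset.sum_congr rfl fun i _ => e.sum_comp (W (e i))).trans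
          (e.sum_comp fun i => ∑ j, W i j)
      have h2 : ∑ i, (η ∘ e) i = ∑ i, η i := e.sum_comp η
      rw [h1, h2]

lemma hasSchroedingerMass_of_isEmpty [IsEmpty ι] : HasSchroedingerMass ι := by
  intro W _ _
  have hpd : ∀ M : Matrix ι ι ℝ, M.PosDef := fun M =>
    PosDef.of_dotProduct_mulVec_pos (by ext i; exact isEmptyElim i)
      fun x hx => absurd (Subsingleton.elim _ _) hx
  refine ⟨by simp [hpd], fun η _ => ?_⟩
  rw [volume_pi, Measure.pi_of_empty (x := isEmptyElim), lintegral_dirac]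
  simp [schroedingerDensity, hpd]

end RandomSchroedinger

section RandomSchroedingerMass

open Matrix

variable {ι : Type*} [Fintype ι] [DecidableEq ι]

lemma continuous_det_diagonal_sub (W : Matrix ι ι ℝ) :
    Continuous fun h : ι → ℝ => (diagonal h - W).det :=
  (continuous_id.matrix_diagonal.sub continuous_const).matrix_det

lemma measurable_dotProduct_inv_mulVec (W : Matrix ι ι ℝ) (u v : ι → ℝ) :
    Measurable fun h : ι → ℝ => u ⬝ᵥ ((diagonal h - W)⁻¹ *ᵥ v) := by
  have hadj : Continuous fun h : ι → ℝ => u ⬝ᵥ ((diagonal h - W).adjugate *ᵥ v) :=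
    continuous_const.dotProduct ((continuous_id.matrix_diagonal.sub
      continuous_const).matrix_adjugate.matrix_mulVec continuous_const)
  have e : (fun h : ι → ℝ => u ⬝ᵥ ((diagonal h - W)⁻¹ *ᵥ v)) = fun h =>
      ((diagonal h - W).det)⁻¹ * (u ⬝ᵥ ((diagonal h - W).adjugate *ᵥ v)) := by
    ext h
    rw [Matrix.inv_def, Ring.inverse_eq_inv', smul_mulVec, dotProduct_smul, smul_eq_mul]
  rw [e]
  exact (continuous_det_diagonal_sub W).measurable.inv.mul hadj.measurable

lemma measurable_schroedingerDensity {W : Matrix ι ι ℝ}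
    (hm : MeasurableSet {h : ι → ℝ | (diagonal h - W).PosDef}) (η : ι → ℝ) :
    Measurable (schroedingerDensity W η) := by
  refine Measurable.ite hm (ENNReal.measurable_ofReal.comp ?_) measurable_const
  refine (continuous_det_diagonal_sub W).measurable.sqrt.inv.mul (measurable_exp.comp ?_)
  exact ((Finset.measurable_sum _ fun i _ => measurable_pi_apply i).add
    (measurable_dotProduct_inv_mulVec W η η)).neg

lemma diagonal_sub_eq_borderedMatrix {W : Matrix (PUnit ⊕ ι) (PUnit ⊕ ι) ℝ} (hW : W.IsSymm)
    (g : PUnit ⊕ ι → ℝ) :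
    diagonal g - W = borderedMatrix (g (Sum.inl ()) - W (Sum.inl ()) (Sum.inl ()))
      (fun i => W (Sum.inr i) (Sum.inl ()))
      (diagonal (fun i => g (Sum.inr i)) - W.submatrix Sum.inr Sum.inr) := by
  ext i j
  rcases i with i | i <;> rcases j with j | j
  · simp [borderedMatrix]
  · simp [borderedMatrix, hW.apply]
  · simp [borderedMatrix]
  · by_cases h : i = j <;> simp [borderedMatrix, h]

/-- Schur complement factorisation of the density with respect to one vertex. -/
lemma schroedingerDensity_bordered {W : Matrix (PUnit ⊕ ι) (PUnit ⊕ ι) ℝ} (hW : W.IsSymm)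
    (η g : PUnit ⊕ ι → ℝ) {a s : ℝ} {w η' h : ι → ℝ} {W' : Matrix ι ι ℝ}
    (ha : a = W (Sum.inl ()) (Sum.inl ())) (hw : w = fun i => W (Sum.inr i) (Sum.inl ()))
    (hW' : W' = W.submatrix Sum.inr Sum.inr) (hs : s = η (Sum.inl ()))
    (hη' : η' = fun i => η (Sum.inr i)) (hh : h = fun i => g (Sum.inr i))
    (hD : (diagonal h - W').PosDef) :
    schroedingerDensity W η g =
      (Set.Ioi 0).indicator (fun x => ENNReal.ofReal ((√x)⁻¹ *
        exp (-(x + (s + w ⬝ᵥ ((diagonal h - W')⁻¹ *ᵥ η')) ^ 2 / x))))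
        (g (Sum.inl ()) - (a + w ⬝ᵥ ((diagonal h - W')⁻¹ *ᵥ w))) *
      (ENNReal.ofReal (exp (2 * (s + w ⬝ᵥ ((diagonal h - W')⁻¹ *ᵥ η')) - a - 2 * s)) *
        schroedingerDensity W' (η' + w) h) := by
  have hM := diagonal_sub_eq_borderedMatrix hW g
  rw [← ha, ← hw, ← hW', ← hh] at hM
  have hηe : η = Sum.elim (fun _ => s) η' := by
    ext i
    rcases i with i | i <;> simp [hs, hη']
  rw [schroedingerDensity, schroedingerDensity, if_pos hD, hM, ← sub_sub]
  set x := g (Sum.inl ()) - a - w ⬝ᵥ ((diagonal h - W')⁻¹ *ᵥ w) with hx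
  by_cases hx0 : 0 < x
  · rw [if_pos ((borderedMatrix_posDef_iff _ _ _).2 ⟨hD, hx0⟩),
      Set.indicator_of_mem (Set.mem_Ioi.2 hx0), ← ENNReal.ofReal_mul (exp_pos _).le,
      ← ENNReal.ofReal_mul (by positivity)]
    congr 1
    rw [hηe, borderedMatrix_quadratic hD hx0, det_borderedMatrix hD, ← hx,
      Real.sqrt_mul hD.det_pos.le, mul_inv, Fintype.sum_sum_type, Finset.univ_unique,
      Finset.sum_singleton]
    have hcomm := dotProduct_inv_mulVec_comm hD η' w
    rw [mulVec_add, dotProduct_add, add_dotProduct, add_dotProduct, hcomm]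
    have hsum : ∑ i, g (Sum.inr i) = ∑ i, h i := by rw [hh]
    rw [hsum]
    set d := √(diagonal h - W').det
    set c := s + w ⬝ᵥ ((diagonal h - W')⁻¹ *ᵥ η') with hc
    have hexp : ∀ u v y z : ℝ, u = v + y + z → d⁻¹ * (√x)⁻¹ * exp u =
        (√x)⁻¹ * exp v * (exp y * (d⁻¹ * exp z)) := by
      rintro u v y z rfl
      rw [exp_add, exp_add]
      ring
    refine hexp _ _ _ _ ?_
    change -(g (Sum.inl ()) + _ + _) = _
    linear_combination -hx
  · rw [if_neg fun h => hx0 ((borderedMatrix_posDef_iff _ _ _).1 h).2,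
      Set.indicator_of_notMem (by simpa using hx0), zero_mul]

lemma HasSchroedingerMass.sum_punit (hι : HasSchroedingerMass ι) :
    HasSchroedingerMass (PUnit.{1} ⊕ ι) := by
  intro W hW hW0
  set a := W (Sum.inl ()) (Sum.inl ()) with ha
  set w : ι → ℝ := fun i => W (Sum.inr i) (Sum.inl ()) with hw
  set W' := W.submatrix Sum.inr Sum.inr with hW'
  obtain ⟨hm, hint⟩ := hι W' (hW.submatrix _) fun i j => hW0 _ _
  have hms : MeasurableSet {g : PUnit ⊕ ι → ℝ | (diagonal g - W).PosDef} := by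
    have e : {g : PUnit ⊕ ι → ℝ | (diagonal g - W).PosDef} =
        (fun g i => g (Sum.inr i)) ⁻¹' {h : ι → ℝ | (diagonal h - W').PosDef} ∩
        {g | 0 < g (Sum.inl ()) - a -
          w ⬝ᵥ ((diagonal (fun i => g (Sum.inr i)) - W')⁻¹ *ᵥ w)} := by
      ext g
      rw [Set.mem_ofPred_eq, diagonal_sub_eq_borderedMatrix hW, borderedMatrix_posDef_iff]
      rfl
    have hr : Measurable fun (g : PUnit ⊕ ι → ℝ) i => g (Sum.inr i) :=
      measurable_pi_iff.2 fun i => measurable_pi_apply _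
    rw [e]
    exact (hr hm).inter (measurableSet_lt measurable_const
      (((measurable_pi_apply _).sub_const _).sub
        ((measurable_dotProduct_inv_mulVec W' w w).comp hr)))
  refine ⟨hms, fun η hη => ?_⟩
  set s := η (Sum.inl ()) with hs
  set η' : ι → ℝ := fun i => η (Sum.inr i) with hη'
  have hmeas := measurable_schroedingerDensity hms η
  have hmp := volume_measurePreserving_sumPiEquivProdPi_symm fun _ : PUnit.{1} ⊕ ι => ℝ
  have hinner : ∀ h : ι → ℝ, ∫⁻ t : PUnit → ℝ, schroedingerDensity W η
      ((MeasurableEquiv.sumPiEquivProdPi fun _ : PUnit ⊕ ι => ℝ).symm (t, h)) =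
      ENNReal.ofReal (√π * exp (-(a + 2 * s))) * schroedingerDensity W' (η' + w) h := by
    intro h
    by_cases hD : (diagonal h - W').PosDef
    swap
    · have hz : schroedingerDensity W' (η' + w) h = 0 := if_neg hD
      rw [hz, mul_zero]
      refine (lintegral_congr fun t => ?_).trans lintegral_zero
      refine if_neg fun hpd => hD ?_
      rw [diagonal_sub_eq_borderedMatrix hW, borderedMatrix_posDef_iff] at hpd
      exact hpd.1
    have hoff : ∀ i j, i ≠ j → (diagonal h - W') i j ≤ 0 := fun i j hij => by
      rw [Matrix.sub_apply, diagonal_apply_ne _ hij, zero_sub, neg_nonpos]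
      exact hW0 _ _
    have hc : 0 ≤ s + w ⬝ᵥ ((diagonal h - W')⁻¹ *ᵥ η') :=
      add_nonneg (hη _) (Finset.sum_nonneg fun i _ =>
        mul_nonneg (hW0 _ _) (inv_mulVec_nonneg hD hoff (fun i => hη _) i))
    have hfac := fun t : PUnit → ℝ => schroedingerDensity_bordered hW η
      ((MeasurableEquiv.sumPiEquivProdPi fun _ : PUnit ⊕ ι => ℝ).symm (t, h)) ha hw hW' hs hη'
      (h := h) rfl hD
    rw [lintegral_congr hfac]
    set c := s + w ⬝ᵥ ((diagonal h - W')⁻¹ *ᵥ η')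
    set k := a + w ⬝ᵥ ((diagonal h - W')⁻¹ *ᵥ w)
    set f : ℝ → ℝ≥0∞ := (Set.Ioi 0).indicator fun x =>
      ENNReal.ofReal ((√x)⁻¹ * exp (-(x + c ^ 2 / x))) with hf
    have hfm : Measurable f := Measurable.indicator (by fun_prop) measurableSet_Ioi
    have h1 : ∫⁻ t : PUnit → ℝ, f (t () - k) = ENNReal.ofReal (√π * exp (-(2 * c))) := by
      have h2 := (volume_preserving_funUnique PUnit.{1} ℝ).lintegral_comp_emb
        (MeasurableEquiv.measurableEmbedding _) fun x => f (x - k)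
      rw [lintegral_sub_right_eq_self f k, hf, lintegral_indicator measurableSet_Ioi,
        lintegral_inverseGaussian hc] at h2
      exact h2
    have hfk : Measurable fun t : PUnit.{1} → ℝ => f (t () - k) :=
      hfm.comp (by fun_prop : Measurable fun t : PUnit.{1} → ℝ => t () - k)
    change ∫⁻ t : PUnit → ℝ, f (t () - k) * _ = _
    rw [lintegral_mul_const _ hfk, h1, ← mul_assoc,
      ← ENNReal.ofReal_mul (by positivity), mul_assoc, ← exp_add]
    congr 4
    ring
  have hfub := lintegral_prod_symm (μ := (volume : Measure (PUnit → ℝ)))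
    (ν := (volume : Measure (ι → ℝ))) _ (hmeas.comp (MeasurableEquiv.measurable
      (MeasurableEquiv.sumPiEquivProdPi fun _ : PUnit.{1} ⊕ ι => ℝ).symm)).aemeasurable
  rw [← hmp.lintegral_comp_emb (MeasurableEquiv.measurableEmbedding _)]
  refine (hfub.trans (lintegral_congr hinner)).trans ?_
  rw [lintegral_const_mul _ (measurable_schroedingerDensity hm _),
    hint (η' + w) fun i => add_nonneg (hη _) (hW0 _ _), ← ENNReal.ofReal_mul (by positivity)]
  congr 1
  rw [Fintype.card_sum, Fintype.card_punit, pow_add, pow_one]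
  have hexp : ∀ u v y : ℝ, y = u + v → √π * exp u * (√π ^ Fintype.card ι * exp v) =
      √π * √π ^ Fintype.card ι * exp y := by
    rintro u v y rfl
    rw [exp_add]
    ring
  refine hexp _ _ _ ?_
  have h1 : ∑ i, W (Sum.inl ()) (Sum.inr i) = ∑ i, w i :=
    Finset.sum_congr rfl fun i _ => hW.apply _ _
  have h2 : ∑ i, η i = s + ∑ i, η' i := by simp [Fintype.sum_sum_type, hs, hη']
  have h3 : ∑ i, ∑ j, W i j = a + ∑ i, W (Sum.inl ()) (Sum.inr i) +
      (∑ i, w i + ∑ i, ∑ j, W' i j) := by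
    simp [Fintype.sum_sum_type, ha, hw, hW', Finset.sum_add_distrib]
    ring
  rw [h3, h2, h1]
  simp only [Pi.add_apply, Finset.sum_add_distrib]
  ring

end RandomSchroedingerMass

theorem hasSchroedingerMass (ι : Type*) [Fintype ι] [DecidableEq ι] : HasSchroedingerMass ι := by
  suffices h : ∀ n : ℕ, HasSchroedingerMass (Fin n) from (h _).of_equiv (Fintype.equivFin ι).symm
  intro n
  induction n with
  | zero => exact hasSchroedingerMass_of_isEmpty
  | succ n ih =>
    exact ih.sum_punit.of_equiv (Fintype.equivOfCardEq (by simp [add_comm]))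

/-- The Laplacian of the weighted graph with the row and column of `x` deleted. -/
def redLap (G : SimpleGraph V) [DecidableRel G.Adj] (x : V) (w : Sym2 V → ℝ) :
    Matrix {v : V // v ≠ x} {v : V // v ≠ x} ℝ :=
  fun i j => (if i = j then vw G w i else 0) - if G.Adj i j then w s(i, j) else 0

/-- The self-map of `V` following the pointers `f` and fixing the root `x`. -/
def follow (x : V) (f : {v : V // v ≠ x} → V) (v : V) : V :=
  if h : v ≠ x then f ⟨v, h⟩ else x

/-- All pointers eventually lead to the root. -/
def IsRooted (x : V) (f : {v : V // v ≠ x} → V) : Prop :=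
  ∀ v, ∃ n, (follow x f)^[n] v = x

lemma follow_coe (x : V) (f : {v : V // v ≠ x} → V) (i : {v : V // v ≠ x}) :
    follow x f i = f i := by simp [follow, i.2]

/-- The matrix `1 - P` with `P` the pointer matrix of `f`. -/
def pointerMatrix (x : V) (f : {v : V // v ≠ x} → V) :
    Matrix {v : V // v ≠ x} {v : V // v ≠ x} ℝ :=
  fun i j => (if i = j then 1 else 0) - if f i = j then 1 else 0

lemma det_pointerMatrix_of_not_isRooted (x : V) (f : {v : V // v ≠ x} → V)
    (hf : ¬ IsRooted x f) : (pointerMatrix x f).det = 0 := by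
  rw [← Matrix.exists_mulVec_eq_zero_iff]
  simp only [IsRooted, not_forall, not_exists] at hf
  obtain ⟨v, hv⟩ := hf
  refine ⟨fun i => if ∀ n, (follow x f)^[n] i ≠ x then 1 else 0, fun h => ?_, ?_⟩
  · have := congrFun h ⟨v, hv 0⟩
    simp [hv] at this
  · ext i
    have key : (∀ n, (follow x f)^[n] i ≠ x) ↔ ∀ n, (follow x f)^[n] (f i) ≠ x := by
      rw [← follow_coe x f i]
      refine ⟨fun h n => h (n + 1), fun h n => ?_⟩
      cases n with
      | zero => exact i.2
      | succ n => exact h n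
    simp only [Matrix.mulVec, dotProduct, pointerMatrix, sub_mul, Finset.sum_sub_distrib, ite_mul,
      one_mul, zero_mul, Finset.sum_ite_eq, Finset.mem_univ, if_true, Pi.zero_apply]
    rw [if_congr key rfl rfl, sub_eq_zero]
    by_cases hx : f i = x
    · rw [if_neg fun h => h 0 hx, Finset.sum_eq_zero]
      intro j _
      rw [if_neg fun h => j.2 (h.symm.trans hx)]
    · rw [Finset.sum_eq_single ⟨f i, hx⟩]
      · simp
      · intro j _ hj
        rw [if_neg fun h => hj (Subtype.ext h.symm)]
      · simp

lemma IsRooted.exists_rank {x : V} {f : {v : V // v ≠ x} → V} (hf : IsRooted x f) :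
    ∃ d : V → ℕ, ∀ i, d (f i) < d i := by
  refine ⟨fun v => Nat.find (hf v), fun i => ?_⟩
  obtain ⟨m, hm⟩ : ∃ m, Nat.find (hf i) = m + 1 := by
    refine Nat.exists_eq_succ_of_ne_zero fun h => i.2 ?_
    have := Nat.find_spec (hf i)
    rwa [h] at this
  show Nat.find (hf (f i)) < Nat.find (hf i)
  rw [hm, Nat.lt_succ_iff]
  apply Nat.find_min'
  have := Nat.find_spec (hf i)
  rwa [hm, Function.iterate_succ_apply, follow_coe] at this

lemma isRooted_of_rank {x : V} {f : {v : V // v ≠ x} → V} (d : V → ℕ)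
    (hd : ∀ i, d (f i) < d i) : IsRooted x f := by
  intro v
  induction h : d v using Nat.strong_induction_on generalizing v with
  | _ n ih =>
    by_cases hv : v = x
    · exact ⟨0, hv⟩
    · obtain ⟨m, hm⟩ := ih _ (h ▸ hd ⟨v, hv⟩) _ rfl
      refine ⟨m + 1, ?_⟩
      rw [Function.iterate_succ_apply, show follow x f v = f ⟨v, hv⟩ from follow_coe x f ⟨v, hv⟩,
        hm]

lemma det_pointerMatrix_of_isRooted (x : V) (f : {v : V // v ≠ x} → V)
    (hf : IsRooted x f) : (pointerMatrix x f).det = 1 := by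
  obtain ⟨d, hd⟩ := hf.exists_rank
  have hz : ∀ i j : {v : V // v ≠ x}, d i ≤ d j → (pointerMatrix x f) i j =
      (1 : Matrix {v : V // v ≠ x} {v : V // v ≠ x} ℝ) i j := by
    intro i j hij
    have : f i ≠ j := fun h => absurd (hd i) (by rw [h]; exact not_lt.2 hij)
    simp [pointerMatrix, this, Matrix.one_apply]
  have hb : (pointerMatrix x f).BlockTriangular fun i => OrderDual.toDual (d i) := by
    intro i j hij
    have hij : d i < d j := hij
    rw [hz i j hij.le, Matrix.one_apply_ne]
    rintro rfl
    exact lt_irrefl _ hij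
  rw [hb.det]
  refine Finset.prod_eq_one fun a _ => ?_
  have : (pointerMatrix x f).toSquareBlock (fun i => OrderDual.toDual (d i)) a = 1 := by
    ext i j
    have : d i = d j := OrderDual.toDual.injective (i.2.trans j.2.symm)
    rw [Matrix.toSquareBlock_def, Matrix.of_apply, hz _ _ this.le, Matrix.one_apply,
      Matrix.one_apply]
    simp [Subtype.ext_iff]
  rw [this, Matrix.det_one]

lemma redLap_eq_sum (G : SimpleGraph V) [DecidableRel G.Adj] (x : V) (w : Sym2 V → ℝ) :
    redLap G x w = fun i : {v : V // v ≠ x} => ∑ k ∈ G.neighborFinset i,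
      w s(i, k) • fun j : {v : V // v ≠ x} =>
        (if i = j then (1 : ℝ) else 0) - if k = j then 1 else 0 := by
  ext i j
  simp only [Finset.sum_apply, Pi.smul_apply, smul_eq_mul, mul_sub, Finset.sum_sub_distrib,
    redLap, mul_ite, mul_one, mul_zero, Finset.sum_ite_eq', SimpleGraph.mem_neighborFinset]
  congr 1
  split_ifs <;> simp [vw]

lemma det_redLap_eq_sum (G : SimpleGraph V) [DecidableRel G.Adj] (x : V) (w : Sym2 V → ℝ) :
    (redLap G x w).det =
      ∑ f ∈ (Fintype.piFinset fun i : {v : V // v ≠ x} => G.neighborFinset i).filter (IsRooted x),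
        ∏ i : {v : V // v ≠ x}, w s((i : V), f i) := by
  rw [redLap_eq_sum]
  have h :=
    (Matrix.detRowAlternating (n := {v : V // v ≠ x}) (R := ℝ)).toMultilinearMap.map_sum_finset
    (fun (i : {v : V // v ≠ x}) (k : V) => w s((i : V), k) • fun j : {v : V // v ≠ x} =>
        (if i = j then (1 : ℝ) else 0) - if k = j then 1 else 0) (fun i => G.neighborFinset i)
  refine Eq.trans h ?_
  rw [Finset.sum_filter]
  refine Finset.sum_congr rfl fun f _ => ?_
  rw [MultilinearMap.map_smul_univ]
  have h1 : Matrix.detRowAlternating.toMultilinearMap (fun (i j : {v : V // v ≠ x}) =>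
      (if i = j then (1 : ℝ) else 0) - if f i = j then 1 else 0) = (pointerMatrix x f).det := rfl
  rw [h1]
  split_ifs with hf
  · rw [det_pointerMatrix_of_isRooted x f hf, smul_eq_mul, mul_one]
  · rw [det_pointerMatrix_of_not_isRooted x f hf, smul_zero]

/-- The edges `{i, f i}` traced by a pointer map. -/
def pointerEdges (x : V) (f : {v : V // v ≠ x} → V) : Finset (Sym2 V) :=
  Finset.univ.image fun i : {v : V // v ≠ x} => s((i : V), f i)

lemma IsRooted.injective_edge {x : V} {f : {v : V // v ≠ x} → V} (hf : IsRooted x f) :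
    Function.Injective fun i : {v : V // v ≠ x} => s((i : V), f i) := by
  obtain ⟨d, hd⟩ := hf.exists_rank
  intro i j hij
  rcases Sym2.eq_iff.1 hij with ⟨h, -⟩ | ⟨h1, h2⟩
  · exact Subtype.ext h
  · have := hd i
    have := hd j
    rw [h2] at *
    rw [← h1] at *
    omega

lemma IsRooted.eq_of_pointerEdges_eq {x : V} {f g : {v : V // v ≠ x} → V} (hf : IsRooted x f)
    (hg : IsRooted x g) (h : pointerEdges x f = pointerEdges x g) : f = g := by
  obtain ⟨d, hd⟩ := hf.exists_rank
  obtain ⟨d', hd'⟩ := hg.exists_rank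
  have step : ∀ i, f i ≠ g i → ∃ k : {v : V // v ≠ x}, (k : V) = f i ∧ g k = i := by
    intro i hi
    have : s((i : V), f i) ∈ pointerEdges x g := by
      rw [← h]
      exact Finset.mem_image_of_mem _ (Finset.mem_univ _)
    obtain ⟨k, -, hk⟩ := Finset.mem_image.1 this
    rcases Sym2.eq_iff.1 hk with ⟨h1, h2⟩ | ⟨h1, h2⟩
    · rw [Subtype.ext h1] at h2
      exact absurd h2.symm hi
    · exact ⟨k, h1, h2⟩
  have main : ∀ n, ∀ i : {v : V // v ≠ x}, d i = n → f i = g i := by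
    intro n
    induction n using Nat.strong_induction_on with
    | _ n ih =>
      intro i hi
      by_contra hne
      obtain ⟨k, hk, hgk⟩ := step i hne
      have hki : d k < n := by rw [hk, ← hi]; exact hd i
      have hfk : f k = i := (ih _ hki k rfl).trans hgk
      have := hd k
      rw [hfk] at this
      omega
  exact funext fun i => main _ i rfl

lemma isTree_pointerEdges {x : V} {f : {v : V // v ≠ x} → V} (hf : IsRooted x f) :
    (SimpleGraph.fromEdgeSet (pointerEdges x f : Set (Sym2 V))).IsTree := by
  obtain ⟨d, hd⟩ := hf.exists_rank
  have hadj : ∀ i : {v : V // v ≠ x},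
      (SimpleGraph.fromEdgeSet (pointerEdges x f : Set (Sym2 V))).Adj i (f i) := by
    intro i
    rw [SimpleGraph.fromEdgeSet_adj]
    refine ⟨Finset.mem_image_of_mem _ (Finset.mem_univ _), fun h => ?_⟩
    have := hd i
    rw [← h] at this
    omega
  have hreach : ∀ v, (SimpleGraph.fromEdgeSet (pointerEdges x f : Set (Sym2 V))).Reachable v x := by
    intro v
    induction h : d v using Nat.strong_induction_on generalizing v with
    | _ n ih =>
      by_cases hv : v = x
      · rw [hv]
      · exact (hadj ⟨v, hv⟩).reachable.trans (ih _ (h ▸ hd ⟨v, hv⟩) _ rfl)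
  rw [SimpleGraph.isTree_iff_connected_and_card]
  refine ⟨(SimpleGraph.connected_iff _).2 ⟨fun u v => (hreach u).trans (hreach v).symm, ⟨x⟩⟩, ?_⟩
  have hE : (SimpleGraph.fromEdgeSet (pointerEdges x f : Set (Sym2 V))).edgeSet =
      (pointerEdges x f : Set (Sym2 V)) := by
    rw [SimpleGraph.edgeSet_fromEdgeSet, sdiff_eq_left, Set.disjoint_left]
    intro e he
    obtain ⟨i, -, rfl⟩ := Finset.mem_image.1 he
    exact fun h => (hadj i).ne (by simpa using h)
  rw [hE, SetLike.coe_sort_coe, Nat.card_eq_fintype_card, Nat.card_eq_fintype_card,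
    Fintype.card_coe,
    pointerEdges,
    Finset.card_image_of_injective _ hf.injective_edge, Finset.card_univ]
  have := Fintype.card_subtype_compl (fun v => v = x)
  rw [Fintype.card_subtype_eq] at this
  have h1 : 0 < Fintype.card V := Fintype.card_pos_iff.2 ⟨x⟩
  have h2 : Fintype.card {v : V // v ≠ x} = Fintype.card V - 1 := this
  omega

lemma exists_pointer_of_isTree {x : V} {F : Finset (Sym2 V)}
    (hF : (SimpleGraph.fromEdgeSet (F : Set (Sym2 V))).IsTree) :
    ∃ f : {v : V // v ≠ x} → V, IsRooted x f ∧ pointerEdges x f ⊆ F := by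
  have hex : ∀ i : {v : V // v ≠ x}, ∃ k, s((i : V), k) ∈ F ∧
      (SimpleGraph.fromEdgeSet (F : Set (Sym2 V))).dist k x <
        (SimpleGraph.fromEdgeSet (F : Set (Sym2 V))).dist i x := by
    rintro ⟨i, hi⟩
    dsimp only
    obtain ⟨p, hp⟩ := hF.connected.exists_walk_length_eq_dist i x
    cases p with
    | nil => exact absurd rfl hi
    | cons hadj q =>
      refine ⟨_, ((SimpleGraph.fromEdgeSet_adj _).1 hadj).1, ?_⟩
      rw [← hp, SimpleGraph.Walk.length_cons]
      exact Nat.lt_succ_of_le (SimpleGraph.dist_le q)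
  choose f hf hd using hex
  refine ⟨f, isRooted_of_rank (fun v => SimpleGraph.dist _ v x) hd, ?_⟩
  intro e he
  obtain ⟨i, -, rfl⟩ := Finset.mem_image.1 he
  exact hf i

/-- **Weighted matrix-tree theorem.** -/
theorem tau_eq_det_redLap (G : SimpleGraph V) [DecidableRel G.Adj] (x : V) (w : Sym2 V → ℝ) :
    tau G w = (redLap G x w).det := by
  rw [det_redLap_eq_sum, tau]
  symm
  refine Finset.sum_bij (fun f _ => pointerEdges x f) ?_ ?_ ?_ ?_
  · intro f hf
    rw [Finset.mem_filter, Fintype.mem_piFinset] at hf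
    rw [spanningTrees, Finset.mem_filter, Finset.mem_powerset]
    refine ⟨fun e he => ?_, isTree_pointerEdges hf.2⟩
    obtain ⟨i, -, rfl⟩ := Finset.mem_image.1 he
    simpa using hf.1 i
  · intro f hf g hg h
    exact (Finset.mem_filter.1 hf).2.eq_of_pointerEdges_eq (Finset.mem_filter.1 hg).2 h
  · intro F hF
    rw [spanningTrees, Finset.mem_filter, Finset.mem_powerset] at hF
    obtain ⟨f, hf, hfF⟩ := exists_pointer_of_isTree (x := x) hF.2
    refine ⟨f, ?_, ?_⟩
    · rw [Finset.mem_filter, Fintype.mem_piFinset]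
      refine ⟨fun i => ?_, hf⟩
      have := hF.1 (hfF (Finset.mem_image_of_mem _ (Finset.mem_univ i)))
      simpa using this
    · have hle : SimpleGraph.fromEdgeSet (pointerEdges x f : Set (Sym2 V)) ≤
          SimpleGraph.fromEdgeSet (F : Set (Sym2 V)) :=
        SimpleGraph.fromEdgeSet_mono (by exact_mod_cast hfF)
      have heq := (SimpleGraph.isTree_iff_minimal_connected.1 hF.2).eq_of_le
        (isTree_pointerEdges hf).connected hle
      refine Finset.Subset.antisymm hfF fun e he => ?_
      have hnd : ¬ e.IsDiag := G.not_isDiag_of_mem_edgeSet (SimpleGraph.mem_edgeFinset.1 (hF.1 he))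
      have h1 : e ∈ (SimpleGraph.fromEdgeSet (F : Set (Sym2 V))).edgeSet := by
        rw [SimpleGraph.edgeSet_fromEdgeSet]
        exact ⟨he, hnd⟩
      rw [← heq, SimpleGraph.edgeSet_fromEdgeSet] at h1
      exact_mod_cast h1.1
  · intro f hf
    rw [pointerEdges,
      Finset.prod_image fun i _ j _ h => (Finset.mem_filter.1 hf).2.injective_edge h]

section GroundState

open Matrix

variable {ι : Type*} [Fintype ι] [DecidableEq ι]

/-- Every nonempty set of vertices is connected by a positive weight to its complement or to
the root, where `η` collects the weights to the root. -/
def IsRootConnected (W : Matrix ι ι ℝ) (η : ι → ℝ) : Prop :=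
  ∀ S : Set ι, S.Nonempty → (∀ i ∈ S, η i = 0) → ∃ i ∈ S, ∃ j, j ∉ S ∧ 0 < W i j

/-- The potential for which `r` solves the Schrödinger equation with source `η`. -/
def groundPotential (W : Matrix ι ι ℝ) (η r : ι → ℝ) : ι → ℝ :=
  fun i => (η i + (W *ᵥ r) i) * (r i)⁻¹

lemma diagonal_groundPotential_mulVec {W : Matrix ι ι ℝ} {η r : ι → ℝ} (hr : ∀ i, 0 < r i) :
    (diagonal (groundPotential W η r) - W) *ᵥ r = η := by
  ext i
  rw [sub_mulVec, Pi.sub_apply, mulVec_diagonal, groundPotential,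
    inv_mul_cancel_right₀ (hr i).ne', add_sub_cancel_right]

lemma eq_groundPotential {W : Matrix ι ι ℝ} {η r h : ι → ℝ} (hr : ∀ i, 0 < r i)
    (heq : (diagonal h - W) *ᵥ r = η) : groundPotential W η r = h := by
  ext i
  rw [groundPotential, ← heq, sub_mulVec, Pi.sub_apply, mulVec_diagonal, sub_add_cancel,
    mul_inv_cancel_right₀ (hr i).ne']

lemma diagonal_groundPotential_quadratic {W : Matrix ι ι ℝ} (hW : W.IsSymm) {η r : ι → ℝ}
    (hr : ∀ i, 0 < r i) (y : ι → ℝ) :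
    (r * y) ⬝ᵥ ((diagonal (groundPotential W η r) - W) *ᵥ (r * y)) =
      ∑ i, η i * r i * y i ^ 2 + (∑ i, ∑ j, W i j * r i * r j * (y i - y j) ^ 2) / 2 := by
  have h1 : (r * y) ⬝ᵥ ((diagonal (groundPotential W η r) - W) *ᵥ (r * y)) =
      ∑ i, η i * r i * y i ^ 2 + ∑ i, ∑ j, W i j * r i * r j * (y i ^ 2 - y i * y j) := by
    rw [dotProduct, ← Finset.sum_add_distrib]
    refine Finset.sum_congr rfl fun i _ => ?_
    rw [sub_mulVec, Pi.sub_apply, mulVec_diagonal, groundPotential]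
    have e : ∑ j, W i j * r i * r j * (y i ^ 2 - y i * y j) =
        r i * y i ^ 2 * (W *ᵥ r) i - r i * y i * (W *ᵥ (r * y)) i := by
      simp only [mulVec, dotProduct, Finset.mul_sum, Pi.mul_apply]
      rw [← Finset.sum_sub_distrib]
      exact Finset.sum_congr rfl fun j _ => by ring
    rw [e]
    simp only [Pi.mul_apply]
    have := (hr i).ne'
    field_simp
    ring
  have h2 : ∑ i, ∑ j, W i j * r i * r j * (y i ^ 2 - y i * y j) =
      ∑ i, ∑ j, W i j * r i * r j * (y j ^ 2 - y i * y j) := by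
    rw [Finset.sum_comm]
    refine Finset.sum_congr rfl fun i _ => Finset.sum_congr rfl fun j _ => ?_
    rw [hW.apply i j]
    ring
  rw [h1, add_right_inj, eq_div_iff two_ne_zero, mul_two]
  nth_rewrite 2 [h2]
  rw [← Finset.sum_add_distrib]
  refine Finset.sum_congr rfl fun i _ => ?_
  rw [← Finset.sum_add_distrib]
  exact Finset.sum_congr rfl fun j _ => by ring

lemma posDef_diagonal_groundPotential {W : Matrix ι ι ℝ} (hW : W.IsSymm)
    (hW0 : ∀ i j, 0 ≤ W i j) {η r : ι → ℝ} (hη : ∀ i, 0 ≤ η i) (hconn : IsRootConnected W η)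
    (hr : ∀ i, 0 < r i) : (diagonal (groundPotential W η r) - W).PosDef := by
  refine PosDef.of_dotProduct_mulVec_pos ?_ fun x hx => ?_
  · rw [IsHermitian, conjTranspose_eq_transpose_of_trivial, transpose_sub, diagonal_transpose,
      hW.eq]
  obtain ⟨y, rfl⟩ : ∃ y, x = r * y := ⟨fun i => (r i)⁻¹ * x i, by
    ext i
    simp [(hr i).ne']⟩
  rw [star_trivial, diagonal_groundPotential_quadratic hW hr]
  have hA : ∀ i, 0 ≤ η i * r i * y i ^ 2 := fun i =>
    mul_nonneg (mul_nonneg (hη i) (hr i).le) (sq_nonneg _)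
  have hB : ∀ i j, 0 ≤ W i j * r i * r j * (y i - y j) ^ 2 := fun i j =>
    mul_nonneg (mul_nonneg (mul_nonneg (hW0 i j) (hr i).le) (hr j).le) (sq_nonneg _)
  have hA' := Finset.sum_nonneg fun i (_ : i ∈ Finset.univ) => hA i
  have hB' := Finset.sum_nonneg fun i (_ : i ∈ Finset.univ) =>
    Finset.sum_nonneg fun j (_ : j ∈ Finset.univ) => hB i j
  by_cases hcase : ∀ i ∈ {i | y i ≠ 0}, η i = 0
  · obtain ⟨i, hi, j, hj, hij⟩ := hconn {i | y i ≠ 0} (by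
      by_contra hne
      refine hx (funext fun i => ?_)
      have : y i = 0 := by
        by_contra h
        exact hne ⟨i, h⟩
      simp [this]) hcase
    have hj : y j = 0 := by simpa using hj
    have hi : y i ≠ 0 := hi
    refine add_pos_of_nonneg_of_pos hA' (half_pos ?_)
    refine Finset.sum_pos' (fun i _ => Finset.sum_nonneg fun j _ => hB i j)
      ⟨i, Finset.mem_univ _, Finset.sum_pos' (fun j _ => hB i j) ⟨j, Finset.mem_univ _, ?_⟩⟩
    have := hr i
    have := hr j
    rw [hj, sub_zero]
    positivity
  · push Not at hcase
    obtain ⟨i, hi, hηi⟩ := hcase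
    have hi : y i ≠ 0 := hi
    have hηi : 0 < η i := (hη i).lt_of_ne' hηi
    refine add_pos_of_pos_of_nonneg (Finset.sum_pos' (fun i _ => hA i)
      ⟨i, Finset.mem_univ _, ?_⟩) (div_nonneg hB' two_pos.le)
    have := hr i
    positivity

lemma inv_mulVec_pos {W : Matrix ι ι ℝ} (hW0 : ∀ i j, 0 ≤ W i j) {η h : ι → ℝ}
    (hη : ∀ i, 0 ≤ η i) (hconn : IsRootConnected W η) (hpd : (diagonal h - W).PosDef) (i : ι) :
    0 < ((diagonal h - W)⁻¹ *ᵥ η) i := by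
  set r := (diagonal h - W)⁻¹ *ᵥ η with hrdef
  have hr : ∀ i, 0 ≤ r i := inv_mulVec_nonneg hpd (fun i j hij => by
    rw [Matrix.sub_apply, diagonal_apply_ne _ hij, zero_sub, neg_nonpos]
    exact hW0 _ _) hη
  have heq : (diagonal h - W) *ᵥ r = η := mulVec_inv_mulVec hpd η
  have hzero : ∀ i, r i = 0 → η i = 0 ∧ ∀ j, W i j * r j = 0 := by
    intro i hi
    have h1 := congrFun heq i
    rw [sub_mulVec, Pi.sub_apply, mulVec_diagonal, hi, mul_zero, zero_sub] at h1
    have hnn : ∀ j ∈ Finset.univ, 0 ≤ W i j * r j := fun j _ => mul_nonneg (hW0 i j) (hr j)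
    have h2 : 0 ≤ (W *ᵥ r) i := Finset.sum_nonneg hnn
    have h3 := hη i
    refine ⟨by linarith, fun j => ?_⟩
    have h4 : (W *ᵥ r) i = 0 := by linarith
    exact (Finset.sum_eq_zero_iff_of_nonneg hnn).1 h4 j (Finset.mem_univ _)
  refine (hr i).lt_of_ne' fun hi => ?_
  obtain ⟨k, hk, j, hj, hkj⟩ := hconn {i | r i = 0} ⟨i, hi⟩ fun k hk => (hzero k hk).1
  rcases mul_eq_zero.1 ((hzero k hk).2 j) with h | h
  · exact hkj.ne' h
  · exact hj h

lemma image_groundPotential {W : Matrix ι ι ℝ} (hW : W.IsSymm)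
    (hW0 : ∀ i j, 0 ≤ W i j) {η : ι → ℝ} (hη : ∀ i, 0 ≤ η i) (hconn : IsRootConnected W η) :
    groundPotential W η '' {r | ∀ i, 0 < r i} = {h | (diagonal h - W).PosDef} := by
  ext h
  constructor
  · rintro ⟨r, hr, rfl⟩
    exact posDef_diagonal_groundPotential hW hW0 hη hconn hr
  · intro hpd
    have hr := inv_mulVec_pos hW0 hη hconn hpd
    exact ⟨_, hr, eq_groundPotential hr (mulVec_inv_mulVec hpd η)⟩

lemma hasFDerivAt_groundPotential {W : Matrix ι ι ℝ} {η r : ι → ℝ} (hr : ∀ i, 0 < r i) :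
    HasFDerivAt (groundPotential W η) (LinearMap.toContinuousLinearMap
      (toLin' (-(diagonal (fun i => (r i)⁻¹) * (diagonal (groundPotential W η r) - W))))) r := by
  rw [hasFDerivAt_pi']
  intro i
  have h1 : HasFDerivAt (fun r : ι → ℝ => η i + (W *ᵥ r) i) ((ContinuousLinearMap.proj i).comp
      (LinearMap.toContinuousLinearMap (toLin' W))) r :=
    ((ContinuousLinearMap.proj i).comp
      (LinearMap.toContinuousLinearMap (toLin' W))).hasFDerivAt.const_add (η i)
  have h2 := (hasDerivAt_inv (hr i).ne').comp_hasFDerivAt r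
    (hasFDerivAt_apply (𝕜 := ℝ) i r)
  refine (h1.mul h2).congr_fderiv ?_
  ext v
  simp only [_root_.add_apply, _root_.smul_apply,
    ContinuousLinearMap.comp_apply, ContinuousLinearMap.proj_apply,
    LinearMap.coe_toContinuousLinearMap', toLin'_apply, smul_eq_mul, neg_mulVec, Pi.neg_apply,
    ← mulVec_mulVec, mulVec_diagonal, sub_mulVec, Pi.sub_apply, Function.comp_apply]
  rw [groundPotential]
  have := (hr i).ne'
  field_simp
  ring

/-- Change of variables from the potential to the ground state in the total mass formula. -/
theorem lintegral_groundState {W : Matrix ι ι ℝ} (hW : W.IsSymm)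
    (hW0 : ∀ i j, 0 ≤ W i j) {η : ι → ℝ} (hη : ∀ i, 0 ≤ η i) (hconn : IsRootConnected W η) :
    ∫⁻ r in {r : ι → ℝ | ∀ i, 0 < r i}, ENNReal.ofReal ((∏ i, r i)⁻¹ *
      √(diagonal (groundPotential W η r) - W).det *
      exp (-(∑ i, groundPotential W η r i + η ⬝ᵥ r))) =
    ENNReal.ofReal (√π ^ Fintype.card ι * exp (-(∑ i, ∑ j, W i j + 2 * ∑ i, η i))) := by
  obtain ⟨hm, hint⟩ := hasSchroedingerMass ι W hW hW0
  have hS : MeasurableSet {r : ι → ℝ | ∀ i, 0 < r i} := by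
    rw [Set.ofPred_forall]
    exact MeasurableSet.iInter fun i => measurableSet_lt measurable_const (measurable_pi_apply i)
  have hpd := fun r hr => posDef_diagonal_groundPotential hW hW0 hη hconn (r := r) hr
  have hinj : Set.InjOn (groundPotential W η) {r | ∀ i, 0 < r i} := by
    intro r hr s hs h
    have h1 := inv_mulVec_eq_of_mulVec_eq (hpd r hr) (diagonal_groundPotential_mulVec hr)
    have h2 := inv_mulVec_eq_of_mulVec_eq (hpd s hs) (diagonal_groundPotential_mulVec hs)
    rw [← h1, ← h2, h]
  have h := lintegral_image_eq_lintegral_abs_det_fderiv_mul volume hS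
    (fun r hr => (hasFDerivAt_groundPotential (W := W) (η := η) hr).hasFDerivWithinAt) hinj
    (schroedingerDensity W η)
  rw [image_groundPotential hW hW0 hη hconn] at h
  rw [← hint η hη, ← lintegral_indicator hS]
  have hind : schroedingerDensity W η =
      {h | (diagonal h - W).PosDef}.indicator (schroedingerDensity W η) := by
    refine (Set.indicator_eq_self.2 fun h hh => ?_).symm
    by_contra hne
    exact hh (if_neg hne)
  rw [hind, lintegral_indicator hm, h, lintegral_indicator hS]
  refine setLIntegral_congr_fun hS fun r hr => ?_
  have hp := hpd r hr
  have hr : ∀ i, 0 < r i := hr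
  have hprod : 0 < ∏ i, r i := Finset.prod_pos fun i _ => hr i
  rw [schroedingerDensity, if_pos hp, ← ENNReal.ofReal_mul (abs_nonneg _),
    LinearMap.det_toContinuousLinearMap, LinearMap.det_toLin', det_neg, det_mul, det_diagonal,
    abs_mul, abs_pow, abs_neg, abs_one, one_pow, one_mul, abs_mul, abs_of_pos hp.det_pos,
    Finset.prod_inv_distrib, abs_of_pos (inv_pos.2 hprod),
    inv_mulVec_eq_of_mulVec_eq hp (diagonal_groundPotential_mulVec hr)]
  congr 1
  have hd := hp.det_pos
  set d := (diagonal (groundPotential W η r) - W).det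
  have hs : d = √d * √d := (Real.mul_self_sqrt hd.le).symm
  have hs0 := (Real.sqrt_pos.2 hd).ne'
  nth_rewrite 2 [hs]
  field_simp

end GroundState

section GraphForm

variable (G : SimpleGraph V) [DecidableRel G.Adj]

lemma vw_eq_sum_incident (g : Sym2 V → ℝ) (v : V) :
    vw G g v = ∑ e ∈ G.edgeFinset, if v ∈ e then g e else 0 := by
  rw [vw, ← Finset.sum_filter]
  refine Finset.sum_nbij (fun j => s(v, j)) ?_ ?_ ?_ fun _ _ => rfl
  · intro j hj
    simpa using hj
  · intro j _ k _ h
    exact Sym2.congr_right.1 h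
  · intro e he
    obtain ⟨he, hv⟩ := Finset.mem_filter.1 he
    obtain ⟨j, rfl⟩ := Sym2.mem_iff_exists.1 hv
    exact ⟨j, by simpa using he, rfl⟩

/-- Weighted handshake lemma. -/
lemma sum_mul_vw (ρ : V → ℝ) (g : Sym2 V → ℝ) :
    ∑ v, ρ v * vw G g v = ∑ e ∈ G.edgeFinset, g e * ssum ρ e := by
  simp_rw [vw_eq_sum_incident, Finset.mul_sum]
  rw [Finset.sum_comm]
  refine Finset.sum_congr rfl fun e he => ?_
  induction e with
  | _ i j =>
    have hij : i ≠ j := by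
      rintro rfl
      simp at he
    simp only [mul_ite, mul_zero, ← Finset.sum_filter]
    have : (Finset.univ.filter fun v => v ∈ s(i, j)) = {i, j} := by
      ext v
      simp
    rw [this, Finset.sum_pair hij]
    simp only [ssum, Sym2.lift_mk]
    ring

lemma sum_vw (g : Sym2 V → ℝ) : ∑ v, vw G g v = 2 * ∑ e ∈ G.edgeFinset, g e := by
  have h := sum_mul_vw G (fun _ => 1) g
  simp only [one_mul] at h
  rw [h, Finset.mul_sum]
  refine Finset.sum_congr rfl fun e _ => ?_
  induction e with
  | _ i j =>
    simp only [ssum, Sym2.lift_mk]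
    ring

lemma sprod_pos {ρ : V → ℝ} (hρ : ∀ v, 0 < ρ v) (e : Sym2 V) : 0 < sprod ρ e := by
  induction e with
  | _ i j => exact mul_pos (hρ i) (hρ j)

lemma sprod_exp (l : V → ℝ) (e : Sym2 V) : sprod (fun v => exp (l v)) e = exp (ssum l e) := by
  induction e with
  | _ i j => exact (exp_add _ _).symm

lemma prod_sprod_rpow {ρ : V → ℝ} (hρ : ∀ v, 0 < ρ v) (B : Sym2 V → ℝ) :
    ∏ e ∈ G.edgeFinset, sprod ρ e ^ B e = ∏ v, ρ v ^ vw G B v := by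
  obtain ⟨l, rfl⟩ : ∃ l : V → ℝ, ρ = fun v => exp (l v) :=
    ⟨fun v => Real.log (ρ v), funext fun v => (exp_log (hρ v)).symm⟩
  simp_rw [sprod_exp, ← exp_mul, ← exp_sum]
  rw [sum_mul_vw]
  simp_rw [mul_comm]

/-- Extension of a function off the root by the value `1` at the root. -/
def rootExt (x : V) (r : {v // v ≠ x} → ℝ) : V → ℝ :=
  fun v => if h : v = x then 1 else r ⟨v, h⟩

lemma rootExt_root (x : V) (r : {v // v ≠ x} → ℝ) : rootExt x r x = 1 := dif_pos rfl

lemma rootExt_coe (x : V) (r : {v // v ≠ x} → ℝ) (i : {v // v ≠ x}) : rootExt x r i = r i :=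
  dif_neg i.2

lemma rootExt_pos {x : V} {r : {v // v ≠ x} → ℝ} (hr : ∀ i, 0 < r i) (v : V) :
    0 < rootExt x r v := by
  by_cases h : v = x
  · subst h
    rw [rootExt_root]
    exact one_pos
  · exact (rootExt_coe x r ⟨v, h⟩).symm ▸ hr _

/-- The interaction between the vertices other than the root. -/
def interaction (x : V) (c : Sym2 V → ℝ) : Matrix {v // v ≠ x} {v // v ≠ x} ℝ :=
  fun i j => if G.Adj i j then c s(↑i, ↑j) else 0

/-- The weights of the edges to the root. -/
def rootWeight (x : V) (c : Sym2 V → ℝ) : {v // v ≠ x} → ℝ :=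
  fun i => if G.Adj i x then c s(↑i, x) else 0

lemma isSymm_interaction (x : V) (c : Sym2 V → ℝ) : (interaction G x c).IsSymm := by
  ext i j
  simp only [interaction, Matrix.transpose_apply, G.adj_comm j i, Sym2.eq_swap]

variable {G}

lemma interaction_nonneg {c : Sym2 V → ℝ} (hc : ∀ e ∈ G.edgeFinset, 0 < c e) (x : V)
    (i j : {v // v ≠ x}) : 0 ≤ interaction G x c i j := by
  rw [interaction]
  split_ifs with h
  · exact (hc _ (by simpa using h)).le
  · exact le_rfl

lemma rootWeight_nonneg {c : Sym2 V → ℝ} (hc : ∀ e ∈ G.edgeFinset, 0 < c e) (x : V)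
    (i : {v // v ≠ x}) : 0 ≤ rootWeight G x c i := by
  rw [rootWeight]
  split_ifs with h
  · exact (hc _ (by simpa using h)).le
  · exact le_rfl

lemma isRootConnected_interaction (hG : G.Connected) {c : Sym2 V → ℝ}
    (hc : ∀ e ∈ G.edgeFinset, 0 < c e) (x : V) :
    IsRootConnected (interaction G x c) (rootWeight G x c) := by
  rintro S ⟨k, hk⟩ hS
  obtain ⟨p⟩ := hG.preconnected (k : V) x
  obtain ⟨d, -, ⟨i, hi, hid⟩, hd⟩ := p.exists_boundary_dart (Subtype.val '' S) ⟨k, hk, rfl⟩ (by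
    rintro ⟨i, -, hi⟩
    exact i.2 hi)
  have hadj : G.Adj i d.snd := by
    rw [hid]
    exact d.adj
  have hpos := hc _ (by simpa using hadj : s((i : V), d.snd) ∈ G.edgeFinset)
  have hx : d.snd ≠ x := by
    intro hx
    have h := hS i hi
    rw [hx] at hadj hpos
    rw [rootWeight, if_pos hadj] at h
    exact hpos.ne' h
  refine ⟨i, hi, ⟨d.snd, hx⟩, fun hmem => hd ⟨_, hmem, rfl⟩, ?_⟩
  rw [interaction, if_pos hadj]
  exact hpos

variable (G)

lemma vw_eq_sum_ite (w : Sym2 V → ℝ) (v : V) :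
    vw G w v = ∑ j, if G.Adj v j then w s(v, j) else 0 := by
  rw [vw, SimpleGraph.neighborFinset_eq_filter, Finset.sum_filter]

lemma vw_mul_sprod_coe (x : V) (c : Sym2 V → ℝ) (r : {v // v ≠ x} → ℝ) (i : {v // v ≠ x}) :
    vw G (fun e => c e * sprod (rootExt x r) e) i =
      r i * (rootWeight G x c i + ((interaction G x c).mulVec r) i) := by
  rw [vw_eq_sum_ite, Fintype.sum_eq_add_sum_subtype_ne _ x, mul_add]
  congr 1
  · rw [rootWeight]
    split_ifs
    · simp only [sprod, Sym2.lift_mk, rootExt_coe, rootExt_root]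
      ring
    · rw [mul_zero]
  · rw [Matrix.mulVec, dotProduct, Finset.mul_sum]
    refine Finset.sum_congr rfl fun j _ => ?_
    rw [interaction]
    split_ifs
    · simp only [sprod, Sym2.lift_mk, rootExt_coe]
      ring
    · ring

lemma vw_mul_sprod_root (x : V) (c : Sym2 V → ℝ) (r : {v // v ≠ x} → ℝ) :
    vw G (fun e => c e * sprod (rootExt x r) e) x = rootWeight G x c ⬝ᵥ r := by
  rw [vw_eq_sum_ite, Fintype.sum_eq_add_sum_subtype_ne _ x, if_neg G.irrefl, zero_add, dotProduct]
  refine Finset.sum_congr rfl fun j _ => ?_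
  by_cases hj : G.Adj j x
  · rw [rootWeight, if_pos hj, if_pos hj.symm, Sym2.eq_swap]
    simp only [sprod, Sym2.lift_mk, rootExt_coe, rootExt_root]
    ring
  · rw [rootWeight, if_neg hj, if_neg fun h => hj h.symm, zero_mul]

lemma sum_interaction (x : V) (c : Sym2 V → ℝ) :
    ∑ i, ∑ j, interaction G x c i j + 2 * ∑ i, rootWeight G x c i =
      2 * ∑ e ∈ G.edgeFinset, c e := by
  have h1 := vw_mul_sprod_root G x c fun _ => 1
  have h2 := fun i => vw_mul_sprod_coe G x c (fun _ => 1) i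
  have he : (fun e => c e * sprod (rootExt x fun _ => 1) e) = c := by
    ext e
    have : (rootExt x fun _ => (1 : ℝ)) = fun _ => 1 := by
      ext v
      simp [rootExt]
    rw [this]
    induction e with
    | _ i j => simp [sprod]
  rw [he] at h1
  simp_rw [he] at h2
  rw [← sum_vw, Fintype.sum_eq_add_sum_subtype_ne _ x, h1]
  simp_rw [h2, one_mul]
  simp only [dotProduct, Matrix.mulVec, mul_one, Finset.sum_add_distrib]
  ring

lemma redLap_mul_sprod {x : V} (c : Sym2 V → ℝ) {r : {v // v ≠ x} → ℝ} (hr : ∀ i, 0 < r i) :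
    redLap G x (fun e => c e * sprod (rootExt x r) e) = Matrix.diagonal r *
      (Matrix.diagonal (groundPotential (interaction G x c) (rootWeight G x c) r) -
        interaction G x c) * Matrix.diagonal r := by
  ext i j
  rw [Matrix.mul_diagonal, Matrix.diagonal_mul, Matrix.sub_apply, redLap]
  have e2 : (if G.Adj i j then c s(↑i, ↑j) * sprod (rootExt x r) s(↑i, ↑j) else 0) =
      r i * interaction G x c i j * r j := by
    rw [interaction]
    split_ifs
    · simp only [sprod, Sym2.lift_mk, rootExt_coe]
      ring
    · ring
  rw [e2, mul_sub, sub_mul]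
  congr 1
  by_cases hij : i = j
  · subst hij
    rw [if_pos rfl, Matrix.diagonal_apply_eq, vw_mul_sprod_coe, groundPotential]
    have := (hr i).ne'
    field_simp
  · rw [if_neg hij, Matrix.diagonal_apply_ne _ hij, mul_zero, zero_mul]

variable {G}

/-- The mixing field integral of the vertex reinforced jump process. -/
theorem lintegral_vrjp (hG : G.Connected) (x : V) {c : Sym2 V → ℝ}
    (hc : ∀ e ∈ G.edgeFinset, 0 < c e) :
    ∫⁻ r in {r : {v // v ≠ x} → ℝ | ∀ i, 0 < r i}, ENNReal.ofReal (((∏ i, r i) ^ 2)⁻¹ *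
      √(tau G fun e => c e * sprod (rootExt x r) e) *
      exp (-∑ v, vw G (fun e => c e * sprod (rootExt x r) e) v / rootExt x r v ^ 2)) =
    ENNReal.ofReal (√π ^ (Fintype.card V - 1) * exp (-(2 * ∑ e ∈ G.edgeFinset, c e))) := by
  have h := lintegral_groundState (isSymm_interaction G x c) (interaction_nonneg hc x)
    (rootWeight_nonneg hc x) (isRootConnected_interaction hG hc x)
  rw [sum_interaction, Fintype.card_subtype_compl, Fintype.card_subtype_eq] at h
  rw [← h]
  have hS : MeasurableSet {r : {v // v ≠ x} → ℝ | ∀ i, 0 < r i} := by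
    rw [Set.ofPred_forall]
    exact MeasurableSet.iInter fun i => measurableSet_lt measurable_const (measurable_pi_apply i)
  refine setLIntegral_congr_fun hS fun r hr => ?_
  have hr : ∀ i, 0 < r i := hr
  have hprod : 0 < ∏ i, r i := Finset.prod_pos fun i _ => hr i
  rw [tau_eq_det_redLap G x, redLap_mul_sprod G c hr, Matrix.det_mul, Matrix.det_mul,
    Matrix.det_diagonal]
  have hsq : ∀ d : ℝ, √((∏ i, r i) * d * ∏ i, r i) = (∏ i, r i) * √d := by
    intro d
    rw [show (∏ i, r i) * d * ∏ i, r i = (∏ i, r i) ^ 2 * d by ring,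
      Real.sqrt_mul (sq_nonneg _), Real.sqrt_sq hprod.le]
  rw [hsq, Fintype.sum_eq_add_sum_subtype_ne _ x, vw_mul_sprod_root, rootExt_root, one_pow,
    div_one, add_comm (rootWeight G x c ⬝ᵥ r)]
  congr 2
  · field_simp
  · congr 3
    refine Finset.sum_congr rfl fun i _ => ?_
    rw [vw_mul_sprod_coe, rootExt_coe, groundPotential]
    have := (hr i).ne'
    field_simp

end GraphForm

section Orthant

variable {ι : Type*} [Fintype ι]

/-- The open positive orthant. -/
def orthant (ι : Type*) : Set (ι → ℝ) := {r | ∀ i, 0 < r i}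

lemma orthant_eq_pi : orthant ι = Set.univ.pi fun _ => Set.Ioi 0 := by
  ext r
  simp [orthant]

lemma measurableSet_orthant : MeasurableSet (orthant ι) := by
  rw [orthant_eq_pi]
  exact MeasurableSet.univ_pi fun _ => measurableSet_Ioi

lemma lintegral_orthant_prod {f : ι → ℝ → ℝ} {A : ι → ℝ} (hf : ∀ i, Measurable (f i))
    (hf0 : ∀ i x, 0 < x → 0 ≤ f i x) (hA : ∀ i, 0 ≤ A i)
    (hint : ∀ i, ∫⁻ x in Set.Ioi 0, ENNReal.ofReal (f i x) = ENNReal.ofReal (A i)) :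
    ∫⁻ x in orthant ι, ENNReal.ofReal (∏ i, f i (x i)) = ENNReal.ofReal (∏ i, A i) := by
  have hnn : ∀ i, 0 ≤ᵐ[volume.restrict (Set.Ioi 0)] f i := fun i =>
    (ae_restrict_mem measurableSet_Ioi).mono fun x hx => hf0 i x hx
  have hi : ∀ i, Integrable (f i) (volume.restrict (Set.Ioi 0)) := fun i =>
    ⟨(hf i).aestronglyMeasurable, by
      rw [hasFiniteIntegral_iff_ofReal (hnn i), hint]
      exact ENNReal.ofReal_lt_top⟩
  rw [← ofReal_integral_eq_lintegral_ofReal]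
  · congr 1
    rw [orthant_eq_pi, volume_pi, Measure.restrict_pi_pi, integral_fintype_prod_eq_prod]
    refine Finset.prod_congr rfl fun i _ => ?_
    rw [integral_eq_lintegral_of_nonneg_ae (hnn i) (hf i).aestronglyMeasurable, hint,
      ENNReal.toReal_ofReal (hA i)]
  · rw [orthant_eq_pi, volume_pi, Measure.restrict_pi_pi]
    exact Integrable.fintype_prod hi
  · exact (ae_restrict_mem measurableSet_orthant).mono fun x hx =>
      Finset.prod_nonneg fun i _ => hf0 i _ (hx i)

lemma lintegral_orthant_scale {k : ι → ℝ} (hk : ∀ i, 0 < k i) {f : (ι → ℝ) → ℝ≥0∞}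
    (hf : Measurable f) :
    ∫⁻ u in orthant ι, f u =
      ENNReal.ofReal (∏ i, k i) * ∫⁻ c in orthant ι, f fun i => k i * c i := by
  classical
  have hdet : (Matrix.diagonal k).det = ∏ i, k i := Matrix.det_diagonal
  have hpos : 0 < ∏ i, k i := Finset.prod_pos fun i _ => hk i
  have h := Real.smul_map_diagonal_volume_pi (D := k) (by rw [hdet]; exact hpos.ne')
  have he : (⇑(Matrix.toLin' (Matrix.diagonal k)) : (ι → ℝ) → ι → ℝ) = fun c i => k i * c i := by
    ext c i
    rw [Matrix.toLin'_apply, Matrix.mulVec_diagonal]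
  rw [he, hdet, abs_of_pos hpos] at h
  rw [← lintegral_indicator measurableSet_orthant]
  nth_rewrite 1 [← h]
  rw [lintegral_smul_measure, lintegral_map (hf.indicator measurableSet_orthant) (by fun_prop),
    smul_eq_mul, ← lintegral_indicator measurableSet_orthant]
  congr 1
  refine lintegral_congr fun c => ?_
  simp only [Set.indicator, orthant, Set.mem_ofPred_eq, mul_pos_iff_of_pos_left (hk _)]
  congr

lemma lintegral_Ioi_scale {k : ℝ} (hk : 0 < k) {f : ℝ → ℝ≥0∞} (hf : Measurable f) :
    ∫⁻ s in Set.Ioi 0, f s = ENNReal.ofReal k * ∫⁻ t in Set.Ioi 0, f (k * t) := by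
  rw [← lintegral_indicator measurableSet_Ioi]
  nth_rewrite 1 [← Real.smul_map_volume_mul_left hk.ne']
  rw [lintegral_smul_measure, lintegral_map (hf.indicator measurableSet_Ioi) (by fun_prop),
    smul_eq_mul, ← lintegral_indicator measurableSet_Ioi, abs_of_pos hk]
  congr 1
  refine lintegral_congr fun c => ?_
  simp only [Set.indicator, Set.mem_Ioi, mul_pos_iff_of_pos_left hk]

end Orthant

section Measurability

variable (G : SimpleGraph V) [DecidableRel G.Adj] {α : Type*} [MeasurableSpace α]

lemma Measurable.vw {w : α → Sym2 V → ℝ} (hw : ∀ e, Measurable fun a => w a e) (v : V) :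
    Measurable fun a => vw G (w a) v :=
  Finset.measurable_sum _ fun _ _ => hw _

lemma Measurable.tau {w : α → Sym2 V → ℝ} (hw : ∀ e, Measurable fun a => w a e) :
    Measurable fun a => tau G (w a) :=
  Finset.measurable_sum _ fun _ _ => Finset.measurable_prod _ fun e _ => hw e

lemma Measurable.rootExt {x : V} {r : α → {v // v ≠ x} → ℝ} (hr : Measurable r) (v : V) :
    Measurable fun a => rootExt x (r a) v := by
  by_cases h : v = x
  · simp only [ERRW.rootExt, dif_pos h]
    exact measurable_const
  · simp only [ERRW.rootExt, dif_neg h]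
    exact (measurable_pi_apply _).comp hr

lemma Measurable.sprod {f : α → V → ℝ} (hf : ∀ v, Measurable fun a => f a v) (e : Sym2 V) :
    Measurable fun a => sprod (f a) e := by
  induction e with
  | _ i j => exact (hf i).mul (hf j)

/-- The environment with prescribed value at the reference edge and prescribed values at the
other edges. -/
def pinAt (e0 : Sym2 V) (t : ℝ) (u : Epin G e0 → ℝ) : Sym2 V → ℝ :=
  fun e => if e = e0 then t else if h : e ∈ G.edgeFinset ∧ e ≠ e0 then u ⟨e, h⟩ else 0

lemma Measurable.pinAt {e0 : Sym2 V} {t : α → ℝ} {u : α → Epin G e0 → ℝ} (ht : Measurable t)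
    (hu : Measurable u) (e : Sym2 V) : Measurable fun a => pinAt G e0 (t a) (u a) e := by
  simp only [ERRW.pinAt]
  split_ifs with h h
  · exact ht
  · exact (measurable_pi_apply _).comp hu
  · exact measurable_const

lemma pinAt_ref (e0 : Sym2 V) (t : ℝ) (u : Epin G e0 → ℝ) : pinAt G e0 t u e0 = t := if_pos rfl

lemma pinAt_coe (e0 : Sym2 V) (t : ℝ) (u : Epin G e0 → ℝ) (e : Epin G e0) :
    pinAt G e0 t u e = u e := by
  rw [pinAt, if_neg e.2.2, dif_pos e.2]

lemma pinAt_one (e0 : Sym2 V) (u : Epin G e0 → ℝ) : pinAt G e0 1 u = pinExt G e0 u := rfl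

variable {G}

lemma forall_edge_iff {e0 : Sym2 V} (he0 : e0 ∈ G.edgeFinset) {p : Sym2 V → Prop} :
    (∀ e ∈ G.edgeFinset, p e) ↔ p e0 ∧ ∀ e : Epin G e0, p e := by
  refine ⟨fun h => ⟨h _ he0, fun e => h _ e.2.1⟩, fun h e he => ?_⟩
  by_cases heq : e = e0
  · exact heq ▸ h.1
  · exact h.2 ⟨e, he, heq⟩

lemma prod_edge_eq {e0 : Sym2 V} (he0 : e0 ∈ G.edgeFinset) (f : Sym2 V → ℝ) :
    ∏ e ∈ G.edgeFinset, f e = f e0 * ∏ e : Epin G e0, f e := by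
  rw [← Finset.mul_prod_erase _ _ he0]
  congr 1
  exact Finset.prod_subtype _ (fun e => by rw [Finset.mem_erase, and_comm]) f

lemma pinAt_pos {e0 : Sym2 V} (he0 : e0 ∈ G.edgeFinset) {t : ℝ} (ht : 0 < t)
    {u : Epin G e0 → ℝ} (hu : u ∈ orthant (Epin G e0)) :
    ∀ e ∈ G.edgeFinset, 0 < pinAt G e0 t u e := by
  rw [forall_edge_iff he0]
  refine ⟨by rwa [pinAt_ref], fun e => ?_⟩
  rw [pinAt_coe]
  exact hu e

lemma pinExt_pos_iff {e0 : Sym2 V} (he0 : e0 ∈ G.edgeFinset) (u : Epin G e0 → ℝ) :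
    (∀ e ∈ G.edgeFinset, 0 < pinExt G e0 u e) ↔ u ∈ orthant (Epin G e0) := by
  refine ⟨fun h e => ?_, fun hu => pinAt_pos he0 one_pos hu⟩
  have := h e e.2.1
  rwa [← pinAt_one, pinAt_coe] at this

variable (G)

lemma vw_congr {w w' : Sym2 V → ℝ} (h : ∀ e ∈ G.edgeFinset, w e = w' e) (v : V) :
    vw G w v = vw G w' v :=
  Finset.sum_congr rfl fun j hj => h _ (by simpa using hj)

lemma tau_congr {w w' : Sym2 V → ℝ} (h : ∀ e ∈ G.edgeFinset, w e = w' e) :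
    tau G w = tau G w' :=
  Finset.sum_congr rfl fun _ hF => Finset.prod_congr rfl fun _ he =>
    h _ (Finset.mem_powerset.1 (Finset.mem_filter.1 hF).1 he)

lemma vw_mul (s : ℝ) (w : Sym2 V → ℝ) (v : V) : vw G (fun e => s * w e) v = s * vw G w v :=
  (Finset.mul_sum _ _ _).symm

lemma tau_mul (x : V) (s : ℝ) (w : Sym2 V → ℝ) :
    tau G (fun e => s * w e) = s ^ (Fintype.card V - 1) * tau G w := by
  rw [tau_eq_det_redLap G x, tau_eq_det_redLap G x, ← Fintype.card_subtype_eq x,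
    ← Fintype.card_subtype_compl, ← Matrix.det_smul]
  congr 1
  ext i j
  simp only [redLap, vw_mul, Matrix.smul_apply, smul_eq_mul]
  split_ifs <;> ring

variable {G}

lemma tau_pos (hG : G.Connected) {w : Sym2 V → ℝ} (hw : ∀ e ∈ G.edgeFinset, 0 < w e) :
    0 < tau G w := by
  obtain ⟨T, hT, hTree⟩ := hG.exists_isTree_le
  refine Finset.sum_pos (fun _ hF => Finset.prod_pos fun _ he =>
    hw _ (Finset.mem_powerset.1 (Finset.mem_filter.1 hF).1 he)) ⟨T.edgeFinset, ?_⟩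
  refine Finset.mem_filter.2 ⟨Finset.mem_powerset.2 (SimpleGraph.edgeFinset_mono hT), ?_⟩
  rwa [SimpleGraph.coe_edgeFinset, SimpleGraph.fromEdgeSet_edgeSet]

lemma vw_pos (hG : G.Connected) {e0 : Sym2 V} (he0 : e0 ∈ G.edgeFinset) {w : Sym2 V → ℝ}
    (hw : ∀ e ∈ G.edgeFinset, 0 < w e) (v : V) : 0 < vw G w v := by
  have : Nontrivial V := by
    induction e0 with
    | _ i j =>
      have hij : G.Adj i j := by simpa using he0
      exact ⟨i, j, hij.ne⟩
  obtain ⟨j, hj⟩ := hG.preconnected.exists_adj_of_nontrivial v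
  exact Finset.sum_pos (fun k hk => hw _ (by simpa using hk)) ⟨j, by simpa using hj⟩

lemma bwt_pos (hG : G.Connected) {e0 : Sym2 V} (he0 : e0 ∈ G.edgeFinset) {B : Sym2 V → ℝ}
    (hB : ∀ e ∈ G.edgeFinset, 0 < B e) (x v : V) : 0 < bwt G x B v := by
  have := vw_pos hG he0 hB v
  rw [bwt]
  split_ifs <;> linarith

variable (G)

lemma sum_bwt (x : V) (B : Sym2 V → ℝ) :
    ∑ v, bwt G x B v = ∑ e ∈ G.edgeFinset, B e + ((Fintype.card V : ℝ) - 1) / 2 := by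
  simp only [bwt]
  rw [← Finset.sum_div, Finset.sum_sub_distrib, Finset.sum_add_distrib, sum_vw]
  simp
  ring

end Measurability

section Magic

variable (G : SimpleGraph V) [DecidableRel G.Adj]

lemma lintegral_reverse {α β γ : Type*} [MeasurableSpace α] [MeasurableSpace β]
    [MeasurableSpace γ] {μ : Measure α} {ν : Measure β} {κ : Measure γ} [SFinite μ] [SFinite ν]
    [SFinite κ] {f : α → β → γ → ℝ≥0∞} (hf : Measurable fun p : α × β × γ => f p.1 p.2.1 p.2.2) :
    ∫⁻ a, ∫⁻ b, ∫⁻ c, f a b c ∂κ ∂ν ∂μ = ∫⁻ c, ∫⁻ b, ∫⁻ a, f a b c ∂μ ∂ν ∂κ := by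
  have h1 : Measurable fun p : α × β => ∫⁻ c, f p.1 p.2 c ∂κ :=
    Measurable.lintegral_prod_right'
      (f := fun q : (α × β) × γ => f q.1.1 q.1.2 q.2)
      (hf.comp (f := fun q : (α × β) × γ => (q.1.1, q.1.2, q.2)) (by fun_prop))
  have h2 : Measurable fun p : β × γ => ∫⁻ a, f a p.1 p.2 ∂μ :=
    Measurable.lintegral_prod_right'
      (f := fun q : (β × γ) × α => f q.2 q.1.1 q.1.2)
      (hf.comp (f := fun q : (β × γ) × α => (q.2, q.1.1, q.1.2)) (by fun_prop))
  rw [lintegral_lintegral_swap h1.aemeasurable, lintegral_lintegral_swap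
    (f := fun c b => ∫⁻ a, f a b c ∂μ) (h2.comp measurable_swap).aemeasurable]
  refine lintegral_congr fun b => lintegral_lintegral_swap ?_
  exact (hf.comp (f := fun q : α × γ => (q.1, b, q.2)) (by fun_prop)).aemeasurable

/-- Integrand of a representation of `∏ v, Γ (b v) * W v ^ (-b v)` as a mixture over a time scale
and positive vertex labels. -/
def gammaMixture (x : V) (b W : V → ℝ) (r : {v // v ≠ x} → ℝ) (s : ℝ) : ℝ :=
  s ^ (∑ v, b v - 1) * (∏ i : {v // v ≠ x}, 2 * r i ^ (-(2 * b i) - 1)) *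
    exp (-(s * ∑ v, W v / rootExt x r v ^ 2))

lemma lintegral_gammaMixture (x : V) {b W : V → ℝ} (hb : ∀ v, 0 < b v) (hW : ∀ v, 0 < W v) :
    ∫⁻ s in Set.Ioi 0, ∫⁻ r in orthant {v // v ≠ x}, ENNReal.ofReal (gammaMixture x b W r s) =
      ENNReal.ofReal (∏ v, W v ^ (-b v) * Gamma (b v)) := by
  have hΓ : ∀ v, 0 < W v ^ (-b v) * Gamma (b v) := fun v =>
    mul_pos (rpow_pos_of_pos (hW v) _) (Gamma_pos_of_pos (hb v))
  have inner : ∀ s ∈ Set.Ioi (0 : ℝ),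
      ∫⁻ r in orthant {v // v ≠ x}, ENNReal.ofReal (gammaMixture x b W r s) =
        ENNReal.ofReal (∏ i : {v // v ≠ x}, W i ^ (-b i) * Gamma (b i)) *
          ENNReal.ofReal (s ^ (b x - 1) * exp (-(W x * s))) := by
    intro s hs
    have hs : 0 < s := hs
    have split : ∀ r : {v // v ≠ x} → ℝ, gammaMixture x b W r s =
        s ^ (∑ v, b v - 1) * exp (-(W x * s)) *
          ∏ i : {v // v ≠ x}, 2 * r i ^ (-(2 * b i) - 1) * exp (-(s * W i / r i ^ 2)) := by
      intro r
      rw [gammaMixture,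
        Finset.prod_mul_distrib (g := fun i : {v // v ≠ x} => exp (-(s * W i / r i ^ 2))),
        ← exp_sum, Fintype.sum_eq_add_sum_subtype_ne (fun v => W v / rootExt x r v ^ 2) x]
      simp only [rootExt_root, rootExt_coe]
      rw [mul_assoc, mul_assoc, mul_left_comm (exp (-(W x * s))), ← exp_add]
      congr 3
      rw [mul_add, neg_add, Finset.mul_sum, Finset.sum_neg_distrib]
      simp only [mul_div_assoc]
      ring
    simp only [split]
    have hpos : 0 ≤ s ^ (∑ v, b v - 1) * exp (-(W x * s)) := by positivity
    simp only [ENNReal.ofReal_mul hpos]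
    rw [lintegral_const_mul' _ _ ENNReal.ofReal_ne_top,
      lintegral_orthant_prod (A := fun i : {v // v ≠ x} => (s * W i) ^ (-b i) * Gamma (b i))
        (f := fun (i : {v // v ≠ x}) y => 2 * y ^ (-(2 * b i) - 1) * exp (-(s * W i / y ^ 2)))
        (fun i => by fun_prop)
        (fun i y hy => by positivity)
        (fun i => mul_nonneg (rpow_nonneg (mul_pos hs (hW i)).le _) (Gamma_pos_of_pos (hb i)).le)
        (fun i => lintegral_rpow_mul_exp_div_sq (hb i) (mul_pos hs (hW i))),
      ← ENNReal.ofReal_mul hpos,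
      ← ENNReal.ofReal_mul (Finset.prod_nonneg fun (i : {v // v ≠ x}) _ => (hΓ i).le)]
    congr 1
    have hpow : ∀ i : {v // v ≠ x}, (s * W i) ^ (-b i) * Gamma (b i) =
        s ^ (-b i) * (W i ^ (-b i) * Gamma (b i)) := fun i => by
      rw [mul_rpow hs.le (hW i).le, mul_assoc]
    simp only [hpow]
    rw [Finset.prod_mul_distrib, ← rpow_sum_of_pos hs]
    have : s ^ (∑ v, b v - 1) * s ^ (∑ i : {v // v ≠ x}, -b i) = s ^ (b x - 1) := by
      rw [← rpow_add hs, Fintype.sum_eq_add_sum_subtype_ne b x, Finset.sum_neg_distrib]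
      congr 1
      ring
    rw [← this]
    ring
  rw [setLIntegral_congr_fun measurableSet_Ioi inner,
    lintegral_const_mul' _ _ ENNReal.ofReal_ne_top, lintegral_rpow_mul_exp (hb x) (hW x),
    ← ENNReal.ofReal_mul (Finset.prod_nonneg fun (i : {v // v ≠ x}) _ => (hΓ i).le), mul_comm,
    Fintype.prod_eq_mul_prod_subtype_ne (fun v => W v ^ (-b v) * Gamma (b v)) x]

/-- The change of variables identity between the pinned environment and the edge conductances. -/
lemma gammaMixture_rescale (x : V) (B c : Sym2 V → ℝ) {r : {v // v ≠ x} → ℝ}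
    (hr : ∀ i, 0 < r i) {s : ℝ} (hs : 0 < s) (hc : ∀ e ∈ G.edgeFinset, 0 < c e) :
    s * (∏ e ∈ G.edgeFinset, sprod (rootExt x r) e / s) *
        ((∏ e ∈ G.edgeFinset, (s⁻¹ * (c e * sprod (rootExt x r) e)) ^ (B e - 1)) *
          √(tau G fun e => s⁻¹ * (c e * sprod (rootExt x r) e)) *
          gammaMixture x (bwt G x B)
            (vw G fun e => s⁻¹ * (c e * sprod (rootExt x r) e)) r s) =
      (2 ^ (Fintype.card V - 1) * ∏ e ∈ G.edgeFinset, c e ^ (B e - 1)) *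
        (((∏ i, r i) ^ 2)⁻¹ * √(tau G fun e => c e * sprod (rootExt x r) e) *
          exp (-∑ v, vw G (fun e => c e * sprod (rootExt x r) e) v / rootExt x r v ^ 2)) := by
  set ρ := rootExt x r with hρdef
  have hρ : ∀ v, 0 < ρ v := rootExt_pos hr
  have hk : ∀ e, 0 < sprod ρ e := sprod_pos hρ
  have hcard : ((Fintype.card V - 1 : ℕ) : ℝ) = (Fintype.card V : ℝ) - 1 := by
    rw [Nat.cast_sub (Fintype.card_pos_iff.2 ⟨x⟩), Nat.cast_one]
  have hedge : (∏ e ∈ G.edgeFinset, sprod ρ e / s) *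
      ∏ e ∈ G.edgeFinset, (s⁻¹ * (c e * sprod ρ e)) ^ (B e - 1) =
        s ^ (-∑ e ∈ G.edgeFinset, B e) * (∏ i, r i ^ vw G B i) *
          ∏ e ∈ G.edgeFinset, c e ^ (B e - 1) := by
    have hv : ∏ i, r i ^ vw G B i = ∏ e ∈ G.edgeFinset, sprod ρ e ^ B e := by
      rw [prod_sprod_rpow G hρ, Fintype.prod_eq_mul_prod_subtype_ne (fun v => ρ v ^ vw G B v) x]
      simp only [hρdef, rootExt_root, rootExt_coe, one_rpow, one_mul]
    rw [hv, ← Finset.sum_neg_distrib, rpow_sum_of_pos hs, ← Finset.prod_mul_distrib,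
      ← Finset.prod_mul_distrib, ← Finset.prod_mul_distrib]
    refine Finset.prod_congr rfl fun e he => ?_
    have h1 : s⁻¹ * (c e * sprod ρ e) = sprod ρ e / s * c e := by ring
    rw [h1, mul_rpow (div_pos (hk e) hs).le (hc e he).le, ← mul_assoc, mul_comm (_ / s),
      ← rpow_add_one (div_pos (hk e) hs).ne', sub_add_cancel, div_rpow (hk e).le hs.le,
      rpow_neg hs.le]
    ring
  have htau : √(tau G fun e => s⁻¹ * (c e * sprod ρ e)) =
      s ^ (-(((Fintype.card V : ℝ) - 1) / 2)) * √(tau G fun e => c e * sprod ρ e) := by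
    rw [tau_mul G x, sqrt_mul (by positivity), ← rpow_natCast, hcard, sqrt_eq_rpow,
      ← rpow_mul (by positivity), inv_rpow hs.le, ← rpow_neg hs.le]
    congr 3
    ring
  have hexp : s * ∑ v, vw G (fun e => s⁻¹ * (c e * sprod ρ e)) v / ρ v ^ 2 =
      ∑ v, vw G (fun e => c e * sprod ρ e) v / ρ v ^ 2 := by
    rw [Finset.mul_sum]
    refine Finset.sum_congr rfl fun v _ => ?_
    rw [vw_mul]
    field_simp
  have hlab : (∏ i : {v // v ≠ x}, 2 * r i ^ (-(2 * bwt G x B i) - 1)) * ∏ i, r i ^ vw G B i =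
      2 ^ (Fintype.card V - 1) * ((∏ i, r i) ^ 2)⁻¹ := by
    rw [Finset.prod_mul_distrib, Finset.prod_const, Finset.card_univ,
      Fintype.card_subtype_compl, Fintype.card_subtype_eq, mul_assoc, ← Finset.prod_mul_distrib,
      ← Finset.prod_pow, ← Finset.prod_inv_distrib]
    congr 1
    refine Finset.prod_congr rfl fun i _ => ?_
    rw [← rpow_add (hr i), bwt, if_neg i.2, ← rpow_two, ← rpow_neg (hr i).le]
    congr 1
    ring
  have hs1 : s * s ^ (-∑ e ∈ G.edgeFinset, B e) * s ^ (-(((Fintype.card V : ℝ) - 1) / 2)) *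
      s ^ (∑ v, bwt G x B v - 1) = 1 := by
    nth_rewrite 1 [← rpow_one s]
    rw [← rpow_add hs, ← rpow_add hs, ← rpow_add hs, sum_bwt]
    convert rpow_zero s using 2
    ring
  rw [gammaMixture, htau, hexp]
  calc _ = s * ((∏ e ∈ G.edgeFinset, sprod ρ e / s) *
          ∏ e ∈ G.edgeFinset, (s⁻¹ * (c e * sprod ρ e)) ^ (B e - 1)) *
        s ^ (-(((Fintype.card V : ℝ) - 1) / 2)) * s ^ (∑ v, bwt G x B v - 1) *
        (∏ i : {v // v ≠ x}, 2 * r i ^ (-(2 * bwt G x B i) - 1)) *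
        √(tau G fun e => c e * sprod ρ e) *
        exp (-∑ v, vw G (fun e => c e * sprod ρ e) v / ρ v ^ 2) := by ring
    _ = (s * s ^ (-∑ e ∈ G.edgeFinset, B e) * s ^ (-(((Fintype.card V : ℝ) - 1) / 2)) *
          s ^ (∑ v, bwt G x B v - 1)) *
        ((∏ i : {v // v ≠ x}, 2 * r i ^ (-(2 * bwt G x B i) - 1)) * ∏ i, r i ^ vw G B i) *
        (∏ e ∈ G.edgeFinset, c e ^ (B e - 1)) *
        √(tau G fun e => c e * sprod ρ e) *
        exp (-∑ v, vw G (fun e => c e * sprod ρ e) v / ρ v ^ 2) := by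
      rw [hedge]
      ring
    _ = _ := by
      rw [hs1, hlab]
      ring

end Magic

section MagicFormula

variable {G : SimpleGraph V} [DecidableRel G.Adj]

lemma measurable_gammaMixture {α : Type*} [MeasurableSpace α] (x : V) (b : V → ℝ) {W : α → V → ℝ}
    {r : α → {v // v ≠ x} → ℝ} {s : α → ℝ} (hW : ∀ v, Measurable fun a => W a v)
    (hr : Measurable r) (hs : Measurable s) :
    Measurable fun a => gammaMixture x b (W a) (r a) (s a) := by
  have h1 : ∀ i, Measurable fun a => r a i := fun i => (measurable_pi_apply i).comp hr
  have h2 : ∀ v, Measurable fun a => rootExt x (r a) v := fun v => Measurable.rootExt hr v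
  unfold gammaMixture
  fun_prop

/-- Rescaling of the pinned environment integral, for fixed vertex labels. -/
lemma lintegral_gammaMixture_rescale (x : V) {e0 : Sym2 V} (he0 : e0 ∈ G.edgeFinset)
    (B : Sym2 V → ℝ) {r : {v // v ≠ x} → ℝ} (hr : ∀ i, 0 < r i) :
    ∫⁻ s in Set.Ioi 0, ∫⁻ u in orthant (Epin G e0), ENNReal.ofReal
        ((∏ e ∈ G.edgeFinset, pinAt G e0 1 u e ^ (B e - 1)) * √(tau G (pinAt G e0 1 u)) *
          gammaMixture x (bwt G x B) (vw G (pinAt G e0 1 u)) r s) =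
      ∫⁻ t in Set.Ioi 0, ∫⁻ c in orthant (Epin G e0), ENNReal.ofReal
        ((2 ^ (Fintype.card V - 1) * ∏ e ∈ G.edgeFinset, pinAt G e0 t c e ^ (B e - 1)) *
          (((∏ i, r i) ^ 2)⁻¹ * √(tau G fun e => pinAt G e0 t c e * sprod (rootExt x r) e) *
          exp (-∑ v, vw G (fun e => pinAt G e0 t c e * sprod (rootExt x r) e) v /
            rootExt x r v ^ 2))) := by
  set k := sprod (rootExt x r) with hkdef
  have hk : ∀ e, 0 < k e := sprod_pos (rootExt_pos hr)
  have hmeas : Measurable fun p : ℝ × (Epin G e0 → ℝ) => ENNReal.ofReal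
      ((∏ e ∈ G.edgeFinset, pinAt G e0 1 p.2 e ^ (B e - 1)) * √(tau G (pinAt G e0 1 p.2)) *
        gammaMixture x (bwt G x B) (vw G (pinAt G e0 1 p.2)) r p.1) := by
    have h1 : ∀ e, Measurable fun p : ℝ × (Epin G e0 → ℝ) => pinAt G e0 1 p.2 e := fun e =>
      Measurable.pinAt G measurable_const measurable_snd e
    have h2 := Measurable.tau G h1
    have h3 := measurable_gammaMixture x (bwt G x B) (Measurable.vw G h1) measurable_const
      measurable_fst (r := fun _ => r)
    fun_prop
  rw [lintegral_Ioi_scale (hk e0) hmeas.lintegral_prod_right',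
    ← lintegral_const_mul' _ _ ENNReal.ofReal_ne_top]
  refine setLIntegral_congr_fun measurableSet_Ioi fun t (ht : 0 < t) => ?_
  have hs : 0 < k e0 * t := mul_pos (hk e0) ht
  have hmeas' := hmeas.comp (measurable_prodMk_left (x := k e0 * t))
  dsimp only [Function.comp_def] at hmeas' ⊢
  rw [lintegral_orthant_scale (k := fun e : Epin G e0 => k e / (k e0 * t))
      (fun e => div_pos (hk e) hs) hmeas', ← mul_assoc,
    ← ENNReal.ofReal_mul (hk e0).le, ← lintegral_const_mul' _ _ ENNReal.ofReal_ne_top]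
  refine setLIntegral_congr_fun measurableSet_orthant fun c hc => ?_
  have hpos := pinAt_pos he0 ht hc
  have hw : ∀ e ∈ G.edgeFinset, pinAt G e0 1 (fun i : Epin G e0 => k i / (k e0 * t) * c i) e =
      (k e0 * t)⁻¹ * (pinAt G e0 t c e * k e) := by
    rw [forall_edge_iff he0]
    refine ⟨?_, fun e => ?_⟩
    · rw [pinAt_ref, pinAt_ref, mul_comm t, inv_mul_cancel₀ hs.ne']
    · rw [pinAt_coe, pinAt_coe]
      ring
  have hprod := Finset.prod_congr (s₁ := G.edgeFinset) rfl fun e he =>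
    congrArg (· ^ (B e - 1)) (hw e he)
  beta_reduce at hprod
  have hk0 : 0 ≤ k e0 * ∏ e : Epin G e0, k e / (k e0 * t) :=
    mul_nonneg (hk e0).le (Finset.prod_nonneg fun e _ => (div_pos (hk e) hs).le)
  have hfac : k e0 * ∏ e : Epin G e0, k e / (k e0 * t) =
      k e0 * t * ∏ e ∈ G.edgeFinset, k e / (k e0 * t) := by
    rw [prod_edge_eq he0 fun e => k e / (k e0 * t), ← mul_assoc, mul_div_cancel₀ _ hs.ne']
  rw [← ENNReal.ofReal_mul hk0, hfac, ← gammaMixture_rescale G x B _ hr hs hpos, tau_congr G hw,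
    hprod, funext fun v => vw_congr G hw v]

/-- The unnormalised magic formula. -/
lemma lintegral_pinned (hG : G.Connected) (x : V) {e0 : Sym2 V} (he0 : e0 ∈ G.edgeFinset)
    {B : Sym2 V → ℝ} (hB : ∀ e ∈ G.edgeFinset, 0 < B e) :
    ∫⁻ u in orthant (Epin G e0), ENNReal.ofReal
        ((∏ e ∈ G.edgeFinset, pinAt G e0 1 u e ^ (B e - 1)) * √(tau G (pinAt G e0 1 u)) *
          ∏ v, vw G (pinAt G e0 1 u) v ^ (-bwt G x B v) * Gamma (bwt G x B v)) =
      ENNReal.ofReal (2 ^ (Fintype.card V - 1) * √π ^ (Fintype.card V - 1) *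
        ∏ e ∈ G.edgeFinset, (2 : ℝ) ^ (-B e) * Gamma (B e)) := by
  have h2Γ : ∀ e ∈ G.edgeFinset, 0 < (2 : ℝ) ^ (-B e) * Gamma (B e) := fun e he =>
    mul_pos (rpow_pos_of_pos two_pos _) (Gamma_pos_of_pos (hB e he))
  calc _ = ∫⁻ u in orthant (Epin G e0), ∫⁻ s in Set.Ioi 0, ∫⁻ r in orthant {v // v ≠ x},
        ENNReal.ofReal
        ((∏ e ∈ G.edgeFinset, pinAt G e0 1 u e ^ (B e - 1)) * √(tau G (pinAt G e0 1 u)) *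
          gammaMixture x (bwt G x B) (vw G (pinAt G e0 1 u)) r s) := by
        refine setLIntegral_congr_fun measurableSet_orthant fun u hu => ?_
        have hpos := pinAt_pos he0 one_pos hu
        have h0 : 0 ≤ (∏ e ∈ G.edgeFinset, pinAt G e0 1 u e ^ (B e - 1)) *
            √(tau G (pinAt G e0 1 u)) :=
          mul_nonneg (Finset.prod_nonneg fun e he => rpow_nonneg (hpos e he).le _) (sqrt_nonneg _)
        simp only [ENNReal.ofReal_mul h0]
        rw [← lintegral_gammaMixture x (bwt_pos hG he0 hB x) (vw_pos hG he0 hpos),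
          ← lintegral_const_mul' _ _ ENNReal.ofReal_ne_top]
        refine lintegral_congr fun s => ?_
        rw [lintegral_const_mul' _ _ ENNReal.ofReal_ne_top]
    _ = ∫⁻ r in orthant {v // v ≠ x}, ∫⁻ s in Set.Ioi 0, ∫⁻ u in orthant (Epin G e0),
        ENNReal.ofReal
        ((∏ e ∈ G.edgeFinset, pinAt G e0 1 u e ^ (B e - 1)) * √(tau G (pinAt G e0 1 u)) *
          gammaMixture x (bwt G x B) (vw G (pinAt G e0 1 u)) r s) := by
        apply lintegral_reverse
        have h1 : ∀ e, Measurable fun p : (Epin G e0 → ℝ) × ℝ × ({v // v ≠ x} → ℝ) =>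
            pinAt G e0 1 p.1 e := fun e => Measurable.pinAt G measurable_const measurable_fst e
        have h2 := Measurable.tau G h1
        have h3 := measurable_gammaMixture x (bwt G x B) (Measurable.vw G h1)
          (measurable_snd.comp measurable_snd) (measurable_fst.comp measurable_snd)
        fun_prop
    _ = ∫⁻ r in orthant {v // v ≠ x}, ∫⁻ t in Set.Ioi 0, ∫⁻ c in orthant (Epin G e0),
        ENNReal.ofReal
        ((2 ^ (Fintype.card V - 1) * ∏ e ∈ G.edgeFinset, pinAt G e0 t c e ^ (B e - 1)) *
          (((∏ i, r i) ^ 2)⁻¹ * √(tau G fun e => pinAt G e0 t c e * sprod (rootExt x r) e) *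
          exp (-∑ v, vw G (fun e => pinAt G e0 t c e * sprod (rootExt x r) e) v /
            rootExt x r v ^ 2))) :=
        setLIntegral_congr_fun measurableSet_orthant fun r hr =>
          lintegral_gammaMixture_rescale x he0 B hr
    _ = ∫⁻ c in orthant (Epin G e0), ∫⁻ t in Set.Ioi 0, ∫⁻ r in orthant {v // v ≠ x},
        ENNReal.ofReal
        ((2 ^ (Fintype.card V - 1) * ∏ e ∈ G.edgeFinset, pinAt G e0 t c e ^ (B e - 1)) *
          (((∏ i, r i) ^ 2)⁻¹ * √(tau G fun e => pinAt G e0 t c e * sprod (rootExt x r) e) *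
          exp (-∑ v, vw G (fun e => pinAt G e0 t c e * sprod (rootExt x r) e) v /
            rootExt x r v ^ 2))) := by
        apply lintegral_reverse
        have h1 : ∀ e, Measurable fun p : ({v // v ≠ x} → ℝ) × ℝ × (Epin G e0 → ℝ) =>
            pinAt G e0 p.2.1 p.2.2 e := fun e =>
          Measurable.pinAt G (measurable_fst.comp measurable_snd)
            (measurable_snd.comp measurable_snd) e
        have h2 : ∀ v, Measurable fun p : ({v // v ≠ x} → ℝ) × ℝ × (Epin G e0 → ℝ) =>
            rootExt x p.1 v := fun v => Measurable.rootExt measurable_fst v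
        have h3 : ∀ e, Measurable fun p : ({v // v ≠ x} → ℝ) × ℝ × (Epin G e0 → ℝ) =>
            pinAt G e0 p.2.1 p.2.2 e * sprod (rootExt x p.1) e := fun e =>
          (h1 e).mul (Measurable.sprod h2 e)
        have h4 := Measurable.tau G h3
        have h5 := Measurable.vw G h3
        fun_prop
    _ = ∫⁻ c in orthant (Epin G e0), ∫⁻ t in Set.Ioi 0, ENNReal.ofReal
        (2 ^ (Fintype.card V - 1) * √π ^ (Fintype.card V - 1)) * (ENNReal.ofReal
          (∏ e : Epin G e0, c e ^ (B e - 1) * exp (-(2 * c e))) * ENNReal.ofReal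
          (t ^ (B e0 - 1) * exp (-(2 * t)))) := by
        refine setLIntegral_congr_fun measurableSet_orthant fun c hc => ?_
        refine setLIntegral_congr_fun measurableSet_Ioi fun t (ht : 0 < t) => ?_
        have hpos := pinAt_pos he0 ht hc
        have h0 : 0 ≤ (2 : ℝ) ^ (Fintype.card V - 1) *
            ∏ e ∈ G.edgeFinset, pinAt G e0 t c e ^ (B e - 1) :=
          mul_nonneg (by positivity) (Finset.prod_nonneg fun e he => rpow_nonneg (hpos e he).le _)
        have h1 : 0 ≤ ∏ e : Epin G e0, c e ^ (B e - 1) * exp (-(2 * c e)) :=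
          Finset.prod_nonneg fun e _ => mul_nonneg (rpow_nonneg (hc e).le _) (exp_pos _).le
        simp only [ENNReal.ofReal_mul h0]
        rw [lintegral_const_mul' _ _ ENNReal.ofReal_ne_top]
        refine (congrArg _ (lintegral_vrjp hG x hpos)).trans ?_
        rw [← ENNReal.ofReal_mul h0, ← ENNReal.ofReal_mul h1, ← ENNReal.ofReal_mul (by positivity)]
        congr 1
        have h2 : (∏ e ∈ G.edgeFinset, pinAt G e0 t c e ^ (B e - 1)) *
            exp (-(2 * ∑ e ∈ G.edgeFinset, pinAt G e0 t c e)) =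
            (∏ e : Epin G e0, c e ^ (B e - 1) * exp (-(2 * c e))) *
              (t ^ (B e0 - 1) * exp (-(2 * t))) := by
          rw [Finset.mul_sum, ← Finset.sum_neg_distrib, exp_sum, ← Finset.prod_mul_distrib,
            prod_edge_eq he0 fun e => pinAt G e0 t c e ^ (B e - 1) * exp (-(2 * pinAt G e0 t c e)),
            mul_comm]
          simp only [pinAt_ref, pinAt_coe]
        rw [← h2]
        ring
    _ = _ := by
        have hA : ∀ e : Epin G e0, 0 ≤ (2 : ℝ) ^ (-B e) * Gamma (B e) := fun e =>
          (h2Γ e e.2.1).le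
        simp only [lintegral_const_mul' _ _ ENNReal.ofReal_ne_top,
          lintegral_rpow_mul_exp (hB e0 he0) two_pos,
          lintegral_mul_const' _ _ ENNReal.ofReal_ne_top]
        rw [lintegral_orthant_prod (A := fun e : Epin G e0 => (2 : ℝ) ^ (-B e) * Gamma (B e))
          (f := fun (e : Epin G e0) y => y ^ (B e - 1) * exp (-(2 * y)))
          (fun e => by fun_prop) (fun e y hy => by positivity) hA
          (fun e => lintegral_rpow_mul_exp (hB e e.2.1) two_pos),
          ← ENNReal.ofReal_mul (Finset.prod_nonneg fun e _ => hA e),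
          ← ENNReal.ofReal_mul (by positivity),
          prod_edge_eq he0 fun e => (2 : ℝ) ^ (-B e) * Gamma (B e)]
        congr 2
        rw [mul_comm]

lemma Znorm_pos (hG : G.Connected) (x : V) {e0 : Sym2 V} (he0 : e0 ∈ G.edgeFinset)
    {B : Sym2 V → ℝ} (hB : ∀ e ∈ G.edgeFinset, 0 < B e) : 0 < Znorm G x B := by
  have h1 : 0 < ∏ e ∈ G.edgeFinset, Gamma (B e) :=
    Finset.prod_pos fun e he => Gamma_pos_of_pos (hB e he)
  have h2 : 0 < ∏ v, Gamma (bwt G x B v) :=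
    Finset.prod_pos fun v _ => Gamma_pos_of_pos (bwt_pos hG he0 hB x v)
  unfold Znorm
  positivity

/-- Unnormalised density of the mixing measure. -/
def magicWeight (G : SimpleGraph V) [DecidableRel G.Adj] (x : V) (B w : Sym2 V → ℝ) : ℝ :=
  (∏ e ∈ G.edgeFinset, w e ^ (B e - 1)) * √(tau G w) * ∏ v, vw G w v ^ (-bwt G x B v)

lemma magicWeight_pos (hG : G.Connected) (x : V) {e0 : Sym2 V} (he0 : e0 ∈ G.edgeFinset)
    (B : Sym2 V → ℝ) {w : Sym2 V → ℝ} (hw : ∀ e ∈ G.edgeFinset, 0 < w e) :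
    0 < magicWeight G x B w := by
  have h1 : 0 < ∏ e ∈ G.edgeFinset, w e ^ (B e - 1) :=
    Finset.prod_pos fun e he => rpow_pos_of_pos (hw e he) _
  have h2 : 0 < ∏ v, vw G w v ^ (-bwt G x B v) :=
    Finset.prod_pos fun v _ => rpow_pos_of_pos (vw_pos hG he0 hw v) _
  have h3 := tau_pos hG hw
  unfold magicWeight
  positivity

lemma magicDensity_eq (hG : G.Connected) (x : V) {e0 : Sym2 V} (he0 : e0 ∈ G.edgeFinset)
    (B : Sym2 V → ℝ) {w : Sym2 V → ℝ} (hw : ∀ e ∈ G.edgeFinset, 0 < w e) :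
    magicDensity G x B w = (Znorm G x B)⁻¹ * magicWeight G x B w := by
  have hv := vw_pos hG he0 hw
  have h : vw G w x ^ ((1 : ℝ) / 2) / ∏ v, vw G w v ^ ((vw G B v + 1) / 2) =
      ∏ v, vw G w v ^ (-bwt G x B v) := by
    have h1 : vw G w x ^ ((1 : ℝ) / 2) =
        ∏ v, vw G w v ^ ((if v = x then 1 else 0 : ℝ) / 2) := by
      rw [Finset.prod_eq_single x (fun v _ h => by simp [h]) (by simp), if_pos rfl]
    rw [h1, ← Finset.prod_div_distrib]
    refine Finset.prod_congr rfl fun v _ => ?_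
    rw [← rpow_sub (hv v), bwt]
    congr 1
    ring
  rw [magicWeight, ← h, magicDensity]
  ring

/-- Magic formula: the normalising constant of the mixing measure. -/
theorem lintegral_magicWeight (hG : G.Connected) (x : V) {e0 : Sym2 V} (he0 : e0 ∈ G.edgeFinset)
    {B : Sym2 V → ℝ} (hB : ∀ e ∈ G.edgeFinset, 0 < B e) :
    ∫⁻ u in orthant (Epin G e0), ENNReal.ofReal (magicWeight G x B (pinExt G e0 u)) =
      ENNReal.ofReal (Znorm G x B) := by
  have hΓ : 0 < ∏ v, Gamma (bwt G x B v) :=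
    Finset.prod_pos fun v _ => Gamma_pos_of_pos (bwt_pos hG he0 hB x v)
  have hcard : ((Fintype.card V - 1 : ℕ) : ℝ) = (Fintype.card V : ℝ) - 1 := by
    rw [Nat.cast_sub (Fintype.card_pos_iff.2 ⟨x⟩), Nat.cast_one]
  have hZ : Znorm G x B = (∏ v, Gamma (bwt G x B v))⁻¹ *
      (2 ^ (Fintype.card V - 1) * √π ^ (Fintype.card V - 1) *
        ∏ e ∈ G.edgeFinset, (2 : ℝ) ^ (-B e) * Gamma (B e)) := by
    rw [Finset.prod_mul_distrib, ← rpow_sum_of_pos two_pos, ← rpow_natCast 2,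
      ← rpow_natCast (√π), hcard, sqrt_eq_rpow, ← rpow_mul pi_pos.le, Znorm,
      Finset.sum_neg_distrib]
    have h : (2 : ℝ) ^ ((1 : ℝ) - Fintype.card V + ∑ e ∈ G.edgeFinset, B e) =
        ((2 : ℝ) ^ ((Fintype.card V : ℝ) - 1) * (2 : ℝ) ^ (-∑ e ∈ G.edgeFinset, B e))⁻¹ := by
      rw [← rpow_add two_pos, ← rpow_neg two_pos.le]
      congr 1
      ring
    rw [h, div_inv_eq_mul]
    ring_nf
  rw [hZ, ENNReal.ofReal_mul (inv_nonneg.2 hΓ.le), ← lintegral_pinned hG x he0 hB,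
    ← lintegral_const_mul' _ _ ENNReal.ofReal_ne_top]
  refine lintegral_congr fun u => ?_
  rw [← ENNReal.ofReal_mul (inv_nonneg.2 hΓ.le), magicWeight, Finset.prod_mul_distrib, pinAt_one]
  congr 1
  field_simp

end MagicFormula

section Environment

open ProbabilityTheory

variable {G : SimpleGraph V} [DecidableRel G.Adj]

/-- Lebesgue measure on positive pinned environments. -/
def pinnedVolume (G : SimpleGraph V) [DecidableRel G.Adj] (e0 : Sym2 V) :
    Measure (Sym2 V → ℝ) :=
  Measure.map (pinExt G e0) (volume.restrict (orthant (Epin G e0)))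

lemma measurable_pinExt (G : SimpleGraph V) [DecidableRel G.Adj] (e0 : Sym2 V) :
    Measurable (pinExt G e0) :=
  measurable_pi_iff.2 fun e => Measurable.pinAt G measurable_const measurable_id e

lemma ae_pinnedVolume_pos {e0 : Sym2 V} (he0 : e0 ∈ G.edgeFinset) :
    ∀ᵐ w ∂pinnedVolume G e0, ∀ e ∈ G.edgeFinset, 0 < w e := by
  have hm : MeasurableSet {w : Sym2 V → ℝ | ∀ e ∈ G.edgeFinset, 0 < w e} := by
    measurability
  rw [pinnedVolume, ae_map_iff (measurable_pinExt G e0).aemeasurable hm]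
  exact (ae_restrict_mem measurableSet_orthant).mono fun u hu => pinAt_pos he0 one_pos hu

lemma measurable_magicWeight (G : SimpleGraph V) [DecidableRel G.Adj] (x : V) (B : Sym2 V → ℝ) :
    Measurable (magicWeight G x B) := by
  have h1 : ∀ e, Measurable fun w : Sym2 V → ℝ => w e := measurable_pi_apply
  have h2 := Measurable.tau G h1
  have h3 := Measurable.vw G h1
  unfold magicWeight
  fun_prop

/-- The mixing measure is absolutely continuous with an explicit density. -/
lemma mixing_eq_withDensity (hG : G.Connected) (x : V) {e0 : Sym2 V} (he0 : e0 ∈ G.edgeFinset)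
    (B : Sym2 V → ℝ) :
    mixing G e0 x B = (pinnedVolume G e0).withDensity fun w =>
      ENNReal.ofReal ((Znorm G x B)⁻¹ * magicWeight G x B w) := by
  have hp := measurable_pinExt G e0
  have hm : Measurable fun w => ENNReal.ofReal ((Znorm G x B)⁻¹ * magicWeight G x B w) :=
    ((measurable_magicWeight G x B).const_mul _).ennreal_ofReal
  have hind : (fun u => ENNReal.ofReal (if ∀ e ∈ G.edgeFinset, 0 < pinExt G e0 u e then
      magicDensity G x B (pinExt G e0 u) else 0)) = (orthant (Epin G e0)).indicator fun u =>
        ENNReal.ofReal ((Znorm G x B)⁻¹ * magicWeight G x B (pinExt G e0 u)) := by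
    ext u
    by_cases hu : u ∈ orthant (Epin G e0)
    · have hpos := (pinExt_pos_iff he0 u).2 hu
      rw [Set.indicator_of_mem hu, if_pos hpos, magicDensity_eq hG x he0 B hpos]
    · rw [Set.indicator_of_notMem hu, if_neg (mt (pinExt_pos_iff he0 u).1 hu),
        ENNReal.ofReal_zero]
  rw [mixing, hind, withDensity_indicator measurableSet_orthant, pinnedVolume]
  ext s hs
  rw [Measure.map_apply hp hs, withDensity_apply _ (hp hs), withDensity_apply _ hs,
    setLIntegral_map hs hm hp]

lemma lintegral_pinnedVolume_magicWeight (hG : G.Connected) (x : V) {e0 : Sym2 V}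
    (he0 : e0 ∈ G.edgeFinset) {B : Sym2 V → ℝ} (hB : ∀ e ∈ G.edgeFinset, 0 < B e) :
    ∫⁻ w, ENNReal.ofReal (magicWeight G x B w) ∂pinnedVolume G e0 =
      ENNReal.ofReal (Znorm G x B) := by
  rw [pinnedVolume, lintegral_map (measurable_magicWeight G x B).ennreal_ofReal
    (measurable_pinExt G e0), lintegral_magicWeight hG x he0 hB]

lemma isProbabilityMeasure_mixing (hG : G.Connected) (x : V) {e0 : Sym2 V}
    (he0 : e0 ∈ G.edgeFinset) {B : Sym2 V → ℝ} (hB : ∀ e ∈ G.edgeFinset, 0 < B e) :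
    IsProbabilityMeasure (mixing G e0 x B) := by
  have hZ := Znorm_pos hG x he0 hB
  constructor
  rw [mixing_eq_withDensity hG x he0, withDensity_apply _ MeasurableSet.univ,
    Measure.restrict_univ]
  simp only [ENNReal.ofReal_mul (inv_pos.2 hZ).le]
  rw [lintegral_const_mul' _ _ ENNReal.ofReal_ne_top,
    lintegral_pinnedVolume_magicWeight hG x he0 hB, ← ENNReal.ofReal_mul (inv_pos.2 hZ).le,
    inv_mul_cancel₀ hZ.ne', ENNReal.ofReal_one]

/-- The linear statistic of the log-weights conjugate to a shift `δ` of the edge parameters. -/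
def logStat (G : SimpleGraph V) [DecidableRel G.Adj] (δ w : Sym2 V → ℝ) : ℝ :=
  ∑ e ∈ G.edgeFinset, δ e * log (w e) - ∑ v, vw G δ v / 2 * log (vw G w v)

lemma measurable_logStat (G : SimpleGraph V) [DecidableRel G.Adj] (δ : Sym2 V → ℝ) :
    Measurable (logStat G δ) := by
  have h1 : ∀ e, Measurable fun w : Sym2 V → ℝ => w e := measurable_pi_apply
  have h3 := Measurable.vw G h1
  unfold logStat
  fun_prop

lemma measurable_exp_neg_logStat (G : SimpleGraph V) [DecidableRel G.Adj] (C : ℝ)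
    (δ : Sym2 V → ℝ) :
    Measurable fun w => ENNReal.ofReal (C * exp (-logStat G δ w)) :=
  ((measurable_logStat G δ).neg.exp.const_mul C).ennreal_ofReal

lemma vw_add_mul (G : SimpleGraph V) [DecidableRel G.Adj] (a δ : Sym2 V → ℝ) (t : ℝ) (v : V) :
    vw G (fun e => a e + t * δ e) v = vw G a v + t * vw G δ v := by
  simp only [vw, Finset.sum_add_distrib, Finset.mul_sum]

lemma bwt_add_mul (G : SimpleGraph V) [DecidableRel G.Adj] (x : V) (a δ : Sym2 V → ℝ) (t : ℝ)
    (v : V) : bwt G x (fun e => a e + t * δ e) v = bwt G x a v + t * (vw G δ v / 2) := by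
  simp only [bwt, vw_add_mul]
  ring

/-- The mixing measures form an exponential family. -/
lemma magicWeight_add_mul (hG : G.Connected) (x : V) {e0 : Sym2 V} (he0 : e0 ∈ G.edgeFinset)
    (a δ : Sym2 V → ℝ) (t : ℝ) {w : Sym2 V → ℝ} (hw : ∀ e ∈ G.edgeFinset, 0 < w e) :
    magicWeight G x (fun e => a e + t * δ e) w =
      magicWeight G x a w * exp (t * logStat G δ w) := by
  have hv := vw_pos hG he0 hw
  have h1 : ∏ e ∈ G.edgeFinset, w e ^ (a e + t * δ e - 1) =
      (∏ e ∈ G.edgeFinset, w e ^ (a e - 1)) *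
        exp (t * ∑ e ∈ G.edgeFinset, δ e * log (w e)) := by
    rw [Finset.mul_sum, exp_sum, ← Finset.prod_mul_distrib]
    refine Finset.prod_congr rfl fun e he => ?_
    rw [rpow_def_of_pos (hw e he), rpow_def_of_pos (hw e he), ← exp_add]
    ring_nf
  have h2 : ∏ v, vw G w v ^ (-bwt G x (fun e => a e + t * δ e) v) =
      (∏ v, vw G w v ^ (-bwt G x a v)) *
        exp (-(t * ∑ v, vw G δ v / 2 * log (vw G w v))) := by
    rw [Finset.mul_sum, ← Finset.sum_neg_distrib, exp_sum, ← Finset.prod_mul_distrib]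
    refine Finset.prod_congr rfl fun v _ => ?_
    rw [bwt_add_mul, rpow_def_of_pos (hv v), rpow_def_of_pos (hv v), ← exp_add]
    ring_nf
  rw [magicWeight, h1, h2, logStat, mul_sub, sub_eq_add_neg, exp_add, magicWeight]
  ring

lemma lintegral_exp_logStat (hG : G.Connected) (x : V) {e0 : Sym2 V} (he0 : e0 ∈ G.edgeFinset)
    {a δ : Sym2 V → ℝ} (ha : ∀ e ∈ G.edgeFinset, 0 < a e) {t : ℝ}
    (ht : ∀ e ∈ G.edgeFinset, 0 < a e + t * δ e) :
    ∫⁻ w, ENNReal.ofReal (exp (t * logStat G δ w)) ∂mixing G e0 x a =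
      ENNReal.ofReal (Znorm G x (fun e => a e + t * δ e) / Znorm G x a) := by
  have hZ := inv_pos.2 (Znorm_pos hG x he0 ha)
  rw [mixing_eq_withDensity hG x he0, lintegral_withDensity_eq_lintegral_mul _
    ((measurable_magicWeight G x a).const_mul _).ennreal_ofReal
    ((measurable_logStat G δ).const_mul t).exp.ennreal_ofReal, div_eq_inv_mul,
    ENNReal.ofReal_mul hZ.le, ← lintegral_pinnedVolume_magicWeight hG x he0 ht,
    ← lintegral_const_mul' _ _ ENNReal.ofReal_ne_top]
  refine lintegral_congr_ae ((ae_pinnedVolume_pos he0).mono fun w hw => ?_)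
  beta_reduce
  rw [Pi.mul_apply, ← ENNReal.ofReal_mul (mul_pos hZ (magicWeight_pos hG x he0 a hw)).le,
    ← ENNReal.ofReal_mul hZ.le, magicWeight_add_mul hG x he0 a δ t hw, mul_assoc]

lemma eventually_add_mul_pos {a : Sym2 V → ℝ} (δ : Sym2 V → ℝ)
    (ha : ∀ e ∈ G.edgeFinset, 0 < a e) :
    ∀ᶠ t in nhds (0 : ℝ), ∀ e ∈ G.edgeFinset, 0 < a e + t * δ e := by
  rw [Filter.eventually_all_finset]
  intro e he
  have hc : Continuous fun t : ℝ => a e + t * δ e := by fun_prop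
  exact hc.continuousAt.eventually (lt_mem_nhds (by simpa using ha e he))

lemma integrable_exp_logStat (hG : G.Connected) (x : V) {e0 : Sym2 V} (he0 : e0 ∈ G.edgeFinset)
    {a δ : Sym2 V → ℝ} (ha : ∀ e ∈ G.edgeFinset, 0 < a e) {t : ℝ}
    (ht : ∀ e ∈ G.edgeFinset, 0 < a e + t * δ e) :
    Integrable (fun w => exp (t * logStat G δ w)) (mixing G e0 x a) := by
  refine ⟨((measurable_logStat G δ).const_mul t).exp.aestronglyMeasurable, ?_⟩
  rw [hasFiniteIntegral_iff_ofReal (Eventually.of_forall fun w => (exp_pos _).le),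
    lintegral_exp_logStat hG x he0 ha ht]
  exact ENNReal.ofReal_lt_top

lemma mgf_logStat (hG : G.Connected) (x : V) {e0 : Sym2 V} (he0 : e0 ∈ G.edgeFinset)
    {a δ : Sym2 V → ℝ} (ha : ∀ e ∈ G.edgeFinset, 0 < a e) {t : ℝ}
    (ht : ∀ e ∈ G.edgeFinset, 0 < a e + t * δ e) :
    mgf (logStat G δ) (mixing G e0 x a) t =
      Znorm G x (fun e => a e + t * δ e) / Znorm G x a := by
  rw [mgf, integral_eq_lintegral_of_nonneg_ae (Eventually.of_forall fun w => (exp_pos _).le)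
    ((measurable_logStat G δ).const_mul t).exp.aestronglyMeasurable,
    lintegral_exp_logStat hG x he0 ha ht, ENNReal.toReal_ofReal
      (div_pos (Znorm_pos hG x he0 ht) (Znorm_pos hG x he0 ha)).le]

lemma zero_mem_interior_integrableExpSet (hG : G.Connected) (x : V) {e0 : Sym2 V}
    (he0 : e0 ∈ G.edgeFinset) {a : Sym2 V → ℝ} (δ : Sym2 V → ℝ)
    (ha : ∀ e ∈ G.edgeFinset, 0 < a e) :
    0 ∈ interior (integrableExpSet (logStat G δ) (mixing G e0 x a)) :=
  mem_interior_iff_mem_nhds.2 <| (eventually_add_mul_pos δ ha).mono fun _ ht =>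
    integrable_exp_logStat hG x he0 ha ht

lemma hasDerivAt_log_Gamma {y : ℝ} (hy : 0 < y) :
    HasDerivAt (fun y => log (Gamma y)) (digamma y) y :=
  ((differentiableAt_Gamma fun m => by
    have : (0 : ℝ) ≤ m := m.cast_nonneg
    linarith).log (Gamma_pos_of_pos hy).ne').hasDerivAt

lemma log_Znorm (hG : G.Connected) (x : V) {e0 : Sym2 V} (he0 : e0 ∈ G.edgeFinset)
    {B : Sym2 V → ℝ} (hB : ∀ e ∈ G.edgeFinset, 0 < B e) :
    log (Znorm G x B) = ∑ e ∈ G.edgeFinset, log (Gamma (B e)) - ∑ v, log (Gamma (bwt G x B v)) +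
      ((Fintype.card V : ℝ) - 1) / 2 * log π -
        (1 - (Fintype.card V : ℝ) + ∑ e ∈ G.edgeFinset, B e) * log 2 := by
  have h1 : ∀ e ∈ G.edgeFinset, Gamma (B e) ≠ 0 := fun e he => (Gamma_pos_of_pos (hB e he)).ne'
  have h2 : ∀ v ∈ Finset.univ, Gamma (bwt G x B v) ≠ 0 := fun v _ =>
    (Gamma_pos_of_pos (bwt_pos hG he0 hB x v)).ne'
  have h3 := Finset.prod_ne_zero_iff.2 h1
  have h4 := Finset.prod_ne_zero_iff.2 h2
  have h5 := (rpow_pos_of_pos pi_pos (((Fintype.card V : ℝ) - 1) / 2)).ne'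
  rw [Znorm, log_div (mul_ne_zero (div_ne_zero h3 h4) h5) (rpow_pos_of_pos two_pos _).ne',
    log_mul (div_ne_zero h3 h4) h5, log_div h3 h4, log_prod h1, log_prod h2, log_rpow pi_pos,
    log_rpow two_pos]

/-- The mean of the linear statistic is a logarithmic derivative of the normalising constant. -/
lemma integral_logStat (hG : G.Connected) (x : V) {e0 : Sym2 V} (he0 : e0 ∈ G.edgeFinset)
    {a : Sym2 V → ℝ} (δ : Sym2 V → ℝ) (ha : ∀ e ∈ G.edgeFinset, 0 < a e) :
    ∫ w, logStat G δ w ∂mixing G e0 x a =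
      ∑ e ∈ G.edgeFinset, δ e * digamma (a e) - ∑ v, vw G δ v / 2 * digamma (bwt G x a v) -
        (∑ e ∈ G.edgeFinset, δ e) * log 2 := by
  have := isProbabilityMeasure_mixing hG x he0 ha
  have hlin : ∀ p q : ℝ, HasDerivAt (fun t : ℝ => p + t * q) q 0 := fun p q => by
    simpa using ((hasDerivAt_id (0 : ℝ)).mul_const q).const_add p
  have hlogΓ : ∀ {p : ℝ} (q : ℝ), 0 < p →
      HasDerivAt (fun t : ℝ => log (Gamma (p + t * q))) (q * digamma p) 0 := fun {p} q hp => by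
    have h := hasDerivAt_log_Gamma hp
    rw [show p = p + 0 * q by ring] at h
    have h' := h.comp 0 (hlin p q)
    rw [Function.comp_def, zero_mul, add_zero, mul_comm] at h'
    exact h'
  have hd : HasDerivAt (fun t : ℝ =>
      ∑ e ∈ G.edgeFinset, log (Gamma (a e + t * δ e)) -
        ∑ v, log (Gamma (bwt G x a v + t * (vw G δ v / 2))) +
      ((Fintype.card V : ℝ) - 1) / 2 * log π -
        (1 - (Fintype.card V : ℝ) + ∑ e ∈ G.edgeFinset, (a e + t * δ e)) * log 2 -
      log (Znorm G x a))
      (∑ e ∈ G.edgeFinset, δ e * digamma (a e) - ∑ v, vw G δ v / 2 * digamma (bwt G x a v) -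
        (∑ e ∈ G.edgeFinset, δ e) * log 2) 0 :=
    ((((HasDerivAt.fun_sum fun e he => hlogΓ (δ e) (ha e he)).fun_sub
      (HasDerivAt.fun_sum fun v _ =>
        hlogΓ (vw G δ v / 2) (bwt_pos hG he0 ha x v))).add_const _).fun_sub
      (((HasDerivAt.fun_sum fun e _ => hlin (a e) (δ e)).const_add _).mul_const _)).sub_const _
  have hcgf : cgf (logStat G δ) (mixing G e0 x a) =ᶠ[nhds 0] fun t : ℝ =>
      ∑ e ∈ G.edgeFinset, log (Gamma (a e + t * δ e)) -
        ∑ v, log (Gamma (bwt G x a v + t * (vw G δ v / 2))) +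
      ((Fintype.card V : ℝ) - 1) / 2 * log π -
        (1 - (Fintype.card V : ℝ) + ∑ e ∈ G.edgeFinset, (a e + t * δ e)) * log 2 -
      log (Znorm G x a) := by
    filter_upwards [eventually_add_mul_pos δ ha] with t ht
    rw [cgf, mgf_logStat hG x he0 ha ht, log_div (Znorm_pos hG x he0 ht).ne'
      (Znorm_pos hG x he0 ha).ne', log_Znorm hG x he0 ht]
    simp only [bwt_add_mul]
  have h := deriv_cgf_zero (zero_mem_interior_integrableExpSet hG x he0 δ ha)
  rw [probReal_univ, div_one] at h
  rw [← h, hcgf.deriv_eq, hd.deriv]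

/-- The Radon–Nikodym derivative between two mixing measures. -/
lemma mixing_eq_withDensity_mixing (hG : G.Connected) (x : V) {e0 : Sym2 V}
    (he0 : e0 ∈ G.edgeFinset) {a0 a1 : Sym2 V → ℝ} (ha0 : ∀ e ∈ G.edgeFinset, 0 < a0 e)
    (ha1 : ∀ e ∈ G.edgeFinset, 0 < a1 e) :
    mixing G e0 x a0 = (mixing G e0 x a1).withDensity fun w => ENNReal.ofReal
      (Znorm G x a1 / Znorm G x a0 * exp (-logStat G (fun e => a1 e - a0 e) w)) := by
  have hZ0 := Znorm_pos hG x he0 ha0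
  have hZ1 := Znorm_pos hG x he0 ha1
  rw [mixing_eq_withDensity hG x he0, mixing_eq_withDensity hG x he0, ← withDensity_mul _
    ((measurable_magicWeight G x a1).const_mul _).ennreal_ofReal
    (measurable_exp_neg_logStat G _ _)]
  refine withDensity_congr_ae ((ae_pinnedVolume_pos he0).mono fun w hw => ?_)
  have h := magicWeight_add_mul hG x he0 a0 (fun e => a1 e - a0 e) 1 hw
  simp only [one_mul, add_sub_cancel] at h
  beta_reduce
  rw [Pi.mul_apply, ← ENNReal.ofReal_mul
    (mul_pos (inv_pos.2 hZ1) (magicWeight_pos hG x he0 a1 hw)).le, h, exp_neg]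
  congr 1
  field_simp

end Environment

/-- Closed form for the environment-level KL divergence.
For two initial weight vectors `A⁽⁰⁾, A⁽¹⁾ ∈ (0,∞)^E`,
`D(μ_0 ‖ μ_1) = Σ_{e∈E} Λ(a_e⁽⁰⁾, a_e⁽¹⁾) − Σ_{v∈V} Λ(b_v⁽⁰⁾, b_v⁽¹⁾)`. -/
theorem env_KL_closed_form
    {V : Type*} [Fintype V] [DecidableEq V]
    (G : SimpleGraph V) [DecidableRel G.Adj] (hG : G.Connected)
    (v0 : V) (e0 : Sym2 V) (he0 : e0 ∈ G.edgeFinset)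
    (a0 a1 : Sym2 V → ℝ)
    (ha0 : ∀ e ∈ G.edgeFinset, 0 < a0 e) (ha1 : ∀ e ∈ G.edgeFinset, 0 < a1 e) :
    KL (mixing G e0 v0 a0) (mixing G e0 v0 a1)
      = (((∑ e ∈ G.edgeFinset, Lam (a0 e) (a1 e))
          - ∑ v : V, Lam (bwt G v0 a0 v) (bwt G v0 a1 v) : ℝ) : EReal) := by
  set δ : Sym2 V → ℝ := fun e => a1 e - a0 e with hδ
  have hZ0 := Znorm_pos hG v0 he0 ha0
  have hZ1 := Znorm_pos hG v0 he0 ha1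
  have := isProbabilityMeasure_mixing hG v0 he0 ha0
  have := isProbabilityMeasure_mixing hG v0 he0 ha1
  have hden := mixing_eq_withDensity_mixing hG v0 he0 ha0 ha1
  have hac : mixing G e0 v0 a0 ≪ mixing G e0 v0 a1 :=
    hden ▸ withDensity_absolutelyContinuous _ _
  have hrn : ∀ᵐ w ∂mixing G e0 v0 a0,
      log (((mixing G e0 v0 a0).rnDeriv (mixing G e0 v0 a1) w).toReal) =
        log (Znorm G v0 a1) - log (Znorm G v0 a0) - logStat G δ w := by
    have h := Measure.rnDeriv_withDensity (mixing G e0 v0 a1)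
      (measurable_exp_neg_logStat G (Znorm G v0 a1 / Znorm G v0 a0) δ)
    rw [← hden] at h
    filter_upwards [hac.ae_le h] with w hw
    have hq := div_pos hZ1 hZ0
    rw [hw, ENNReal.toReal_ofReal (mul_pos hq (exp_pos _)).le,
      log_mul hq.ne' (exp_pos _).ne', log_exp, log_div hZ1.ne' hZ0.ne']
    ring
  have hint : Integrable (logStat G δ) (mixing G e0 v0 a0) :=
    ProbabilityTheory.integrable_of_mem_interior_integrableExpSet
      (zero_mem_interior_integrableExpSet hG v0 he0 δ ha0)
  have hb : ∀ v, vw G δ v / 2 = bwt G v0 a1 v - bwt G v0 a0 v := fun v => by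
    have h := bwt_add_mul G v0 a0 δ 1 v
    simp only [hδ, one_mul, add_sub_cancel] at h
    rw [h, add_sub_cancel_left]
  rw [KL, if_pos hac, integral_congr_ae hrn, integral_sub (integrable_const _) hint,
    integral_const, probReal_univ, one_smul, integral_logStat hG v0 he0 δ ha0,
    log_Znorm hG v0 he0 ha0, log_Znorm hG v0 he0 ha1]
  congr 1
  simp only [hb]
  simp only [Lam, hδ, Finset.sum_sub_distrib]
  ring

end ERRW
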